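/- arXiv:1609.01877 — 2 statements merged into one kernel-verified Lean document; each statement's English description precedes it below -/
import Mathlib

section
/- For every integer k with 2 ≤ k ≤ n−1, the set X_k(K) is nonempty if and only if there exists a point P ∈ ℙ²(K) with m_P(C) ≥ k, i.e., if and only if C has at least one singular point of multiplicity at least k. -/
open MvPolynomial

noncomputable section

/-- The coefficient `a_i` of `s^(n-i) t^i` in a binary form `f` of degree `n`. -/
def bcoeff {K : Type*} [Field K] (n : ℕ) (f : MvPolynomial (Fin 2) K) (i : Fin (n + 1)) : K :=
  MvPolynomial.coeff (Finsupp.single 0 (n - (i : ℕ)) + Finsupp.single 1 (i : ℕ)) f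

/-- The binary form of degree `k` with coefficient vector `x`. -/
def formOf {K : Type*} [Field K] (k : ℕ) (x : Fin (k + 1) → K) : MvPolynomial (Fin 2) K :=
  ∑ i : Fin (k + 1),
    MvPolynomial.C (x i) * MvPolynomial.X 0 ^ (k - (i : ℕ)) * MvPolynomial.X 1 ^ (i : ℕ)

/-- The matrix `M_k` associated to the parameterization `f`: the first `n-k+1` rows contain
the variables `x_0, …, x_k` in staircase position, the last three rows are the coefficient
vectors of `f_0, f_1, f_2`. -/
def Mmat {K : Type*} [Field K] (n k : ℕ) (f : Fin 3 → MvPolynomial (Fin 2) K) :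
    Matrix (Fin (n - k + 4)) (Fin (n + 1)) (MvPolynomial (Fin (k + 1)) K) :=
  fun j c =>
    if hj : (j : ℕ) ≤ n - k then
      if h : (j : ℕ) ≤ (c : ℕ) ∧ (c : ℕ) ≤ (j : ℕ) + k then
        MvPolynomial.X ⟨(c : ℕ) - (j : ℕ), by omega⟩
      else 0
    else
      MvPolynomial.C (bcoeff n (f ⟨(j : ℕ) - (n - k + 1), by have := j.isLt; omega⟩) c)

/-- The set of `(n-k+3) × (n-k+3)` minors of the matrix `M_k`; it generates the ideal
`I_{X_k}`. -/
def minorsSet {K : Type*} [Field K] (n k : ℕ) (f : Fin 3 → MvPolynomial (Fin 2) K) :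
    Set (MvPolynomial (Fin (k + 1)) K) :=
  { g | ∃ (r : Fin (n - k + 3) → Fin (n - k + 4)) (c : Fin (n - k + 3) → Fin (n + 1)),
      Function.Injective r ∧ Function.Injective c ∧
      g = ((Mmat n k f).submatrix r c).det }

/-- The projective zero locus `X_k(K) ⊆ ℙ^k(K)` of the ideal of minors of `M_k`. -/
def XkSet {K : Type*} [Field K] (n k : ℕ) (f : Fin 3 → MvPolynomial (Fin 2) K) :
    Set (Projectivization K (Fin (k + 1) → K)) :=
  { P | ∀ g ∈ minorsSet n k f, MvPolynomial.eval P.rep g = 0 }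

/-- Evaluation of the parameterization at a vector `v ∈ K²`. -/
def evalVec {K : Type*} [Field K] (f : Fin 3 → MvPolynomial (Fin 2) K) (v : Fin 2 → K) :
    Fin 3 → K :=
  fun u => MvPolynomial.eval v (f u)

/-- The induced map `f : ℙ¹(K) → ℙ²(K)` (with a junk value where undefined). -/
def projMap {K : Type*} [Field K] (f : Fin 3 → MvPolynomial (Fin 2) K)
    (P : Projectivization K (Fin 2 → K)) : Projectivization K (Fin 3 → K) :=
  haveI := Classical.propDecidable (evalVec f P.rep ≠ 0)
  if h : evalVec f P.rep ≠ 0 then Projectivization.mk K _ h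
  else Projectivization.mk K (fun _ => 1) (fun hc => one_ne_zero (congrFun hc 0))

/-- `f = (f_0, f_1, f_2)` is a proper parameterization of degree `n`: the `f_u` are
homogeneous of degree `n`, have no common zero outside the origin, and the induced map
`ℙ¹(K) → ℙ²(K)` is injective outside some finite set. -/
structure IsProperParam {K : Type*} [Field K] (n : ℕ)
    (f : Fin 3 → MvPolynomial (Fin 2) K) : Prop where
  homog : ∀ u, (f u).IsHomogeneous n
  no_common_zero : ∀ v : Fin 2 → K, v ≠ 0 → evalVec f v ≠ 0
  gen_injective : ∃ S : Set (Projectivization K (Fin 2 → K)), S.Finite ∧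
    Set.InjOn (projMap f) Sᶜ

/-- The homogeneous vanishing ideal of the point `p ∈ ℙ²(K)`. -/
def pointIdeal {K : Type*} [Field K] (p : Fin 3 → K) : Ideal (MvPolynomial (Fin 3) K) :=
  Ideal.span { L | L.IsHomogeneous 1 ∧ MvPolynomial.eval p L = 0 }

/-- The multiplicity of the curve `{F = 0}` at the point `p`:
the largest `m` with `F ∈ I(p)^m`. -/
def multAt {K : Type*} [Field K] (F : MvPolynomial (Fin 3) K) (p : Fin 3 → K) : ℕ :=
  sSup { m | F ∈ pointIdeal p ^ m }

/-- The cross difference `p_i f_j - p_j f_i`. -/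
def crossDiff {K : Type*} [Field K] (f : Fin 3 → MvPolynomial (Fin 2) K) (p : Fin 3 → K)
    (i j : Fin 3) : MvPolynomial (Fin 2) K :=
  MvPolynomial.C (p i) * f j - MvPolynomial.C (p j) * f i

/-- `G` is a greatest common divisor of the three cross differences `p_i f_j - p_j f_i`,
`0 ≤ i < j ≤ 2`. -/
def IsGcdOfCross {K : Type*} [Field K] (f : Fin 3 → MvPolynomial (Fin 2) K) (p : Fin 3 → K)
    (G : MvPolynomial (Fin 2) K) : Prop :=
  (∀ i j : Fin 3, i < j → G ∣ crossDiff f p i j) ∧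
  (∀ D : MvPolynomial (Fin 2) K, (∀ i j : Fin 3, i < j → D ∣ crossDiff f p i j) → D ∣ G)

/-- The linear binary form with root `v = (v 0 : v 1)`. -/
def linFormOf {K : Type*} [Field K] (v : Fin 2 → K) : MvPolynomial (Fin 2) K :=
  MvPolynomial.C (v 1) * MvPolynomial.X 0 - MvPolynomial.C (v 0) * MvPolynomial.X 1

/-- The multiplicity of `v` as a root of the binary form `h`. -/
def ordAt {K : Type*} [Field K] (v : Fin 2 → K) (h : MvPolynomial (Fin 2) K) : ℕ :=
  sSup { e | linFormOf v ^ e ∣ h }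

/-- The point `x ∈ ℙ²` lies on the conic `4 x₀ x₂ - x₁² = 0`. -/
def onConic {K : Type*} [Field K] (x : Fin 3 → K) : Prop :=
  4 * x 0 * x 2 - x 1 ^ 2 = 0


theorem aux_rows {K : Type*} [Field K] {a b r : ℕ} (M : Matrix (Fin a) (Fin b) K)
    (h : r ≤ M.rank) : ∃ e : Fin r → Fin a, Function.Injective e ∧
      (M.submatrix e id).rank = r := by
  obtain ⟨κ, e, he, hs, hl⟩ := exists_linearIndependent' K M.row
  have : Finite κ := Finite.of_injective e he
  have := Fintype.ofFinite κ
  have hc : Fintype.card κ = M.rank := by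
    rw [Matrix.rank_eq_finrank_span_row, ← hs]
    exact (finrank_span_eq_card hl).symm
  obtain ⟨g⟩ : Nonempty (Fin r ↪ κ) := by
    rw [Function.Embedding.nonempty_iff_card_le]; simp; omega
  refine ⟨e ∘ g, he.comp g.injective, ?_⟩
  have hl2 : LinearIndependent K (M.submatrix (e ∘ g) id).row := hl.comp g g.injective
  simpa using hl2.rank_matrix

theorem aux_minor {K : Type*} [Field K] {a b r : ℕ} (M : Matrix (Fin a) (Fin b) K)
    (h : r ≤ M.rank) : ∃ (e : Fin r → Fin a) (c : Fin r → Fin b), Function.Injective e ∧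
      Function.Injective c ∧ (M.submatrix e c).det ≠ 0 := by
  obtain ⟨e, he, h1⟩ := aux_rows M h
  have h2 : r ≤ ((M.submatrix e id).transpose).rank := by rw [Matrix.rank_transpose, h1]
  obtain ⟨c, hc, h3⟩ := aux_rows _ h2
  refine ⟨e, c, he, hc, ?_⟩
  have h4 : ((M.submatrix e id).transpose.submatrix c id) = (M.submatrix e c).transpose := rfl
  rw [h4, Matrix.rank_transpose] at h3
  intro h0
  obtain ⟨v, hv, hv0⟩ := Matrix.exists_vecMul_eq_zero_iff.mpr h0
  have hl : LinearIndependent K (M.submatrix e c).row := by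
    rw [linearIndependent_iff_card_eq_finrank_span, Set.finrank, ← Matrix.rank_eq_finrank_span_row, h3]
    simp
  have hu := Matrix.linearIndependent_rows_iff_isUnit.mp hl
  rw [Matrix.isUnit_iff_isUnit_det, h0] at hu
  simp at hu

/-- all minors vanish gives two independent left kernel vectors -/
theorem aux_kernel {K : Type*} [Field K] {m b : ℕ} (M : Matrix (Fin (m + 4)) (Fin b) K)
    (h : ∀ (e : Fin (m + 3) → Fin (m + 4)) (c : Fin (m + 3) → Fin b), Function.Injective e →
      Function.Injective c → (M.submatrix e c).det = 0) :
    ∃ z : Fin 2 → Fin (m + 4) → K, LinearIndependent K z ∧ ∀ i, Matrix.vecMul (z i) M = 0 := by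
  have hr : M.rank < m + 3 := by
    by_contra hc
    obtain ⟨e, c, he, hc, h1⟩ := aux_minor M (not_lt.mp hc)
    exact h1 (h e c he hc)
  have h1 := LinearMap.finrank_range_add_finrank_ker (Matrix.vecMulLinear M)
  have h2 : Module.finrank K (LinearMap.range (Matrix.vecMulLinear M)) = M.rank := by
    rw [← Matrix.rank_transpose, Matrix.rank, Matrix.mulVecLin_transpose]
  rw [h2] at h1
  simp at h1
  have h3 : 2 ≤ Module.finrank K (LinearMap.ker (Matrix.vecMulLinear M)) := by omega
  obtain ⟨z, hz⟩ := exists_linearIndependent_of_le_finrank h3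
  refine ⟨fun i => (z i : _), ?_, ?_⟩
  · exact hz.map' (Submodule.subtype _) (Submodule.ker_subtype _)
  · intro i
    exact (z i).2

/-- conversely -/
theorem aux_minors_zero {K : Type*} [Field K] {m b : ℕ} (M : Matrix (Fin (m + 4)) (Fin b) K)
    (z : Fin 2 → Fin (m + 4) → K) (hz : LinearIndependent K z)
    (hk : ∀ i, Matrix.vecMul (z i) M = 0)
    (e : Fin (m + 3) → Fin (m + 4)) (c : Fin (m + 3) → Fin b) (he : Function.Injective e) :
    (M.submatrix e c).det = 0 := by
  have hns : ¬ Function.Surjective e := by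
    intro hs
    have := Fintype.card_le_of_surjective e hs
    simp at this
  simp only [Function.Surjective, not_forall, not_exists] at hns
  obtain ⟨j, hj⟩ := hns
  have hcov : ∀ i, i ≠ j → ∃ l, e l = i := by
    have : Finset.univ.image e = Finset.univ.erase j := by
      apply Finset.eq_of_subset_of_card_le
      · intro x hx
        simp only [Finset.mem_image, Finset.mem_univ, true_and] at hx
        obtain ⟨l, rfl⟩ := hx
        simp [hj l]
      · rw [Finset.card_image_of_injective _ he]
        simp
    intro i hi
    have hi' : i ∈ Finset.univ.image e := by rw [this]; simp [hi]
    simpa using hi'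
  obtain ⟨α, β, hαβ, hw⟩ : ∃ α β : K, (α ≠ 0 ∨ β ≠ 0) ∧ α * z 0 j + β * z 1 j = 0 := by
    by_cases h0 : z 0 j = 0
    · exact ⟨1, 0, by simp, by simp [h0]⟩
    · exact ⟨- z 1 j, z 0 j, by simp [h0], by ring⟩
  set w : Fin (m + 4) → K := α • z 0 + β • z 1 with hwdef
  have hwj : w j = 0 := by simpa [hwdef] using hw
  have hw0 : w ≠ 0 := by
    intro h
    have h5 := Fintype.linearIndependent_iff.mp hz ![α, β] (by simpa [Fin.sum_univ_two] using h)
    have h6 := h5 0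
    have h7 := h5 1
    simp at h6 h7
    simp [h6, h7] at hαβ
  rw [← Matrix.exists_vecMul_eq_zero_iff]
  refine ⟨w ∘ e, ?_, ?_⟩
  · intro h
    apply hw0
    ext i
    by_cases hi : i = j
    · simp [hi, hwj]
    · obtain ⟨l, rfl⟩ := hcov i hi
      exact congrFun h l
  · ext y
    have h1 : Matrix.vecMul w M = 0 := by
      rw [hwdef, Matrix.add_vecMul, Matrix.smul_vecMul, Matrix.smul_vecMul, hk, hk]; simp
    have h2 := congrFun h1 (c y)
    simp only [Matrix.vecMul, dotProduct, Pi.zero_apply, Matrix.submatrix_apply, Function.comp] at h2 ⊢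
    rw [← h2]
    rw [← Finset.sum_image (f := fun x => w x * M x (c y)) (s := Finset.univ) (g := e)]
    · apply Finset.sum_subset (Finset.subset_univ _)
      intro x _ hx
      have : x = j := by
        by_contra hne
        obtain ⟨l, rfl⟩ := hcov x hne
        exact hx (by simp)
      simp [this, hwj]
    · intro x _ y _ h
      exact he h

theorem aux_extend {K : Type*} [Field K] (c : Fin 2 → Fin 3 → K) (hc : LinearIndependent K c) :
    ∃ A B : Matrix (Fin 3) (Fin 3) K, A * B = 1 ∧ A 1 = c 0 ∧ A 2 = c 1 := by
  obtain ⟨v, hv⟩ : ∃ v : Fin 3 → K, v ∉ Submodule.span K (Set.range c) := by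
    by_contra h
    push Not at h
    have h1 : Submodule.span K (Set.range c) = ⊤ := by
      rw [eq_top_iff]; intro x _; exact h x
    have h2 := finrank_span_eq_card hc
    rw [h1] at h2
    simp at h2
  have hl : LinearIndependent K (Matrix.row (Matrix.of (Fin.cons v c))) :=
    hc.finCons hv
  have hu := Matrix.linearIndependent_rows_iff_isUnit.mp hl
  obtain ⟨B, hB⟩ := hu.exists_right_inv
  exact ⟨_, B, hB, rfl, rfl⟩

theorem aux_coeff {K : Type*} [Field K] (n : ℕ) (g : MvPolynomial (Fin 2) K)
    (hg : g.IsHomogeneous n) (i : ℕ) :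
    (aeval ![(1 : Polynomial K), Polynomial.X] g).coeff i =
      if i ≤ n then coeff (Finsupp.single 0 (n - i) + Finsupp.single 1 i) g else 0 := by
  have h1 : ∀ d ∈ g.support, d 0 + d 1 = n := by
    intro d hd
    have := hg (by simpa using hd)
    rw [Finsupp.weight_apply, Finsupp.sum_fintype _ _ (by simp)] at this
    simpa using this
  rw [aeval_def, eval₂_eq', Polynomial.finsetSum_coeff]
  simp only [Fin.prod_univ_two, Matrix.cons_val_zero, Matrix.cons_val_one, one_pow, one_mul,
    Polynomial.algebraMap_eq, Polynomial.coeff_C_mul, Polynomial.coeff_X_pow]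
  split_ifs with hi
  · rw [Finset.sum_eq_single (Finsupp.single 0 (n - i) + Finsupp.single 1 i)]
    · simp
    · intro d hd hne
      rw [if_neg, mul_zero]
      rintro rfl
      apply hne
      have := h1 d hd
      ext j
      fin_cases j
      · simp; omega
      · simp
    · intro h
      simp only [mem_support_iff, not_not] at h
      rw [h, zero_mul]
  · apply Finset.sum_eq_zero
    intro d hd
    have := h1 d hd
    rw [if_neg (by omega), mul_zero]

/-- The dehomogenization of a parameterization. -/
def dehom {K : Type*} [Field K] (f : Fin 3 → MvPolynomial (Fin 2) K) (u : Fin 3) : Polynomial K :=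
  aeval ![(1 : Polynomial K), Polynomial.X] (f u)

theorem dehom_natDegree {K : Type*} [Field K] (n : ℕ) (f : Fin 3 → MvPolynomial (Fin 2) K)
    (hf : ∀ u, (f u).IsHomogeneous n) (u : Fin 3) : (dehom f u).natDegree ≤ n := by
  rw [Polynomial.natDegree_le_iff_coeff_eq_zero]
  intro N hN
  rw [dehom, aux_coeff n _ (hf u), if_neg (by omega)]

def rowP {K : Type*} [Field K] (m : ℕ) (q : Polynomial K) (a : Fin 3 → Polynomial K)
    (j : Fin (m + 4)) : Polynomial K :=
  if hj : (j : ℕ) ≤ m then Polynomial.X ^ (j : ℕ) * q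
  else a ⟨(j : ℕ) - (m + 1), by have := j.isLt; omega⟩

theorem eval_Mmat {K : Type*} [Field K] (n k : ℕ) (hk : k ≤ n)
    (f : Fin 3 → MvPolynomial (Fin 2) K)
    (hf : ∀ u, (f u).IsHomogeneous n) (x : Fin (k + 1) → K) (q : Polynomial K)
    (hq : q.natDegree ≤ k) (hx : ∀ i : Fin (k + 1), q.coeff i = x i) (j) (c) :
    MvPolynomial.eval x (Mmat n k f j c) = (rowP (n - k) q (dehom f) j).coeff c := by
  unfold Mmat rowP
  split_ifs with h1 h2
  · rw [Polynomial.coeff_X_pow_mul', if_pos h2.1, eval_X, ← hx]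
  · rw [Polynomial.coeff_X_pow_mul', map_zero]
    split_ifs with h3
    · rw [Polynomial.coeff_eq_zero_of_natDegree_lt]; omega
    · rfl
  · rw [eval_C, dehom, aux_coeff n _ (hf _), if_pos (by have := c.isLt; omega)]
    rfl

theorem rowP_natDegree {K : Type*} [Field K] (n k : ℕ) (hk : k ≤ n) (q : Polynomial K)
    (hq : q.natDegree ≤ k) (a : Fin 3 → Polynomial K) (ha : ∀ u, (a u).natDegree ≤ n) (j) :
    (rowP (n - k) q a j).natDegree ≤ n := by
  unfold rowP
  split_ifs with h
  · refine Polynomial.natDegree_mul_le.trans ?_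
    rw [Polynomial.natDegree_X_pow]; omega
  · exact ha _

theorem vecMul_iff {K : Type*} [Field K] (n k : ℕ) (hk : k ≤ n)
    (f : Fin 3 → MvPolynomial (Fin 2) K)
    (hf : ∀ u, (f u).IsHomogeneous n) (x : Fin (k + 1) → K) (q : Polynomial K)
    (hq : q.natDegree ≤ k) (hx : ∀ i : Fin (k + 1), q.coeff i = x i) (z : Fin (n - k + 4) → K) :
    Matrix.vecMul z ((Mmat n k f).map (MvPolynomial.eval x)) = 0 ↔
      ∑ j, Polynomial.C (z j) * rowP (n - k) q (dehom f) j = 0 := by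
  constructor
  · intro h
    ext c
    rw [Polynomial.finsetSum_coeff]
    by_cases hc : c ≤ n
    · have := congrFun h ⟨c, by omega⟩
      simp only [Matrix.vecMul, dotProduct, Matrix.map_apply,
        eval_Mmat n k hk f hf x q hq hx] at this
      simpa using this
    · apply Finset.sum_eq_zero
      intro j _
      rw [Polynomial.coeff_C_mul, Polynomial.coeff_eq_zero_of_natDegree_lt, mul_zero]
      have := rowP_natDegree n k hk q hq _ (dehom_natDegree n f hf) j
      omega
  · intro h
    ext c
    have := congrArg (fun p => Polynomial.coeff p c) h
    simp only [Matrix.vecMul, dotProduct, Matrix.map_apply,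
        eval_Mmat n k hk f hf x q hq hx]
    simpa [Polynomial.finsetSum_coeff] using this

theorem sum_rowP {K : Type*} [Field K] (m : ℕ) (q : Polynomial K) (a : Fin 3 → Polynomial K)
    (z : Fin (m + 4) → K) :
    ∑ j, Polynomial.C (z j) * rowP m q a j =
      (∑ j : Fin (m + 1), Polynomial.C (z (Fin.castAdd 3 j)) * Polynomial.X ^ (j : ℕ)) * q +
      ∑ u : Fin 3, Polynomial.C (z (Fin.natAdd (m + 1) u)) * a u := by
  rw [Finset.sum_mul]
  refine (Fin.sum_univ_add (a := m + 1) (b := 3) _).trans ?_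
  congr 1
  · apply Finset.sum_congr rfl
    intro j _
    rw [rowP, dif_pos (by simp; omega)]
    simp [mul_assoc]
  · apply Finset.sum_congr rfl
    intro u _
    rw [rowP, dif_neg (by simp; omega)]
    congr 2
    ext
    simp

theorem sum_X_pow_eq_zero {K : Type*} [Field K] (m : ℕ) (z : Fin (m + 1) → K)
    (h : ∑ j : Fin (m + 1), Polynomial.C (z j) * Polynomial.X ^ (j : ℕ) = 0) : z = 0 := by
  ext j
  have := congrArg (fun p => Polynomial.coeff p (j : ℕ)) h
  simpa [Polynomial.finsetSum_coeff, Polynomial.coeff_X_pow, Fin.val_inj] using this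

/-- The algebraic meaning of a point of `X_k`. -/
def GoodPair {K : Type*} [Field K] (n k : ℕ) (a : Fin 3 → Polynomial K)
    (A : Matrix (Fin 3) (Fin 3) K) : Prop :=
  ∃ q : Polynomial K, q ≠ 0 ∧ q.natDegree ≤ k ∧ ∀ i : Fin 3, i ≠ 0 →
    ∃ b : Polynomial K, b.natDegree ≤ n - k ∧ ∑ u, Polynomial.C (A i u) * a u = q * b

theorem Xk_iff {K : Type*} [Field K] (n k : ℕ) (hk : k ≤ n)
    (f : Fin 3 → MvPolynomial (Fin 2) K)
    (hf : ∀ u, (f u).IsHomogeneous n) :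
    (XkSet n k f).Nonempty ↔ ∃ A B : Matrix (Fin 3) (Fin 3) K, A * B = 1 ∧
      GoodPair n k (dehom f) A := by
  constructor
  · rintro ⟨P, hP⟩
    obtain ⟨z, hz, hz0⟩ := aux_kernel ((Mmat n k f).map (MvPolynomial.eval P.rep)) (by
      intro e c he hc
      have := hP _ ⟨e, c, he, hc, rfl⟩
      rw [RingHom.map_det] at this
      exact this)
    set q : Polynomial K := ∑ i : Fin (k + 1), Polynomial.C (P.rep i) * Polynomial.X ^ (i : ℕ)
      with hqdef
    have hq : q.natDegree ≤ k := by
      refine Polynomial.natDegree_sum_le_of_forall_le _ _ ?_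
      intro i _
      exact (Polynomial.natDegree_C_mul_X_pow_le _ _).trans (by omega)
    have hx : ∀ i : Fin (k + 1), q.coeff i = P.rep i := by
      intro i
      simp [hqdef, Polynomial.finsetSum_coeff, Polynomial.coeff_X_pow, Fin.val_inj]
    have hq0 : q ≠ 0 := fun h => P.rep_nonzero (sum_X_pow_eq_zero k _ h)
    simp only [vecMul_iff n k hk f hf P.rep q hq hx, sum_rowP] at hz0
    have hc : LinearIndependent K (fun i (u : Fin 3) => z i (Fin.natAdd (n - k + 1) u)) := by
      rw [Fintype.linearIndependent_iff] at hz ⊢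
      intro g hg
      apply hz g
      set w := ∑ i, g i • z i with hw
      have hw1 : ∀ u : Fin 3, w (Fin.natAdd (n - k + 1) u) = 0 := by
        intro u
        have := congrFun hg u
        simpa [hw] using this
      have hw2 : ∑ j, Polynomial.C (w j) * rowP (n - k) q (dehom f) j = 0 := by
        have : ∀ j, Polynomial.C (w j) * rowP (n - k) q (dehom f) j =
            ∑ i, Polynomial.C (g i) * (Polynomial.C (z i j) * rowP (n - k) q (dehom f) j) := by
          intro j
          simp [hw, Finset.sum_mul, mul_assoc, add_mul]
        simp only [this]
        rw [Finset.sum_comm]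
        apply Finset.sum_eq_zero
        intro i _
        rw [← Finset.mul_sum, sum_rowP, hz0 i, mul_zero]
      rw [sum_rowP] at hw2
      simp only [hw1, map_zero, zero_mul, Finset.sum_const_zero, add_zero, mul_eq_zero, hq0,
        or_false] at hw2
      have hw3 := sum_X_pow_eq_zero _ _ hw2
      ext j
      refine Fin.addCases (m := n - k + 1) (n := 3) (motive := fun j => w j = 0) ?_ ?_ j
      · intro i; exact congrFun hw3 i
      · exact hw1
    obtain ⟨A, B, hAB, hA1, hA2⟩ := aux_extend _ hc
    refine ⟨A, B, hAB, q, hq0, hq, ?_⟩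
    have key : ∀ i : Fin 2, ∃ b : Polynomial K, b.natDegree ≤ n - k ∧
        ∑ u, Polynomial.C (z i (Fin.natAdd (n - k + 1) u)) * dehom f u = q * b := by
      intro i
      refine ⟨-∑ j : Fin (n - k + 1), Polynomial.C (z i (Fin.castAdd 3 j)) * Polynomial.X ^ (j : ℕ),
        ?_, ?_⟩
      · rw [Polynomial.natDegree_neg]
        refine Polynomial.natDegree_sum_le_of_forall_le _ _ ?_
        intro i _
        exact (Polynomial.natDegree_C_mul_X_pow_le _ _).trans (by omega)
      · linear_combination hz0 i
    intro i hi
    fin_cases i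
    · exact absurd rfl hi
    · simpa [hA1] using key 0
    · simpa [hA2] using key 1
  · rintro ⟨A, B, hAB, q, hq0, hq, hb⟩
    set x : Fin (k + 1) → K := fun i => q.coeff i with hxdef
    have hx0 : x ≠ 0 := by
      intro h
      apply hq0
      ext i
      by_cases hi : i ≤ k
      · exact congrFun h ⟨i, by omega⟩
      · rw [Polynomial.coeff_eq_zero_of_natDegree_lt (by omega), Polynomial.coeff_zero]
    refine ⟨Projectivization.mk K x hx0, ?_⟩
    obtain ⟨s, hs⟩ := Projectivization.exists_smul_eq_mk_rep K x hx0
    rintro g ⟨r, c, hr, hc, rfl⟩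
    rw [← hs, RingHom.map_det]
    obtain ⟨b1, hb1, hb1'⟩ := hb 1 (by decide)
    obtain ⟨b2, hb2, hb2'⟩ := hb 2 (by decide)
    set b : Fin 2 → Polynomial K := ![b1, b2] with hbdef
    set z : Fin 2 → Fin (n - k + 4) → K := fun i =>
      Fin.append (m := n - k + 1) (n := 3) (fun j => - (s⁻¹ : Kˣ) * (b i).coeff j)
        (A i.succ) with hzdef
    refine aux_minors_zero ((Mmat n k f).map (MvPolynomial.eval (s • x))) z ?_ ?_ r c hr
    · have hA : LinearIndependent K A.row :=
        Matrix.linearIndependent_rows_iff_isUnit.mpr (IsUnit.of_mul_eq_one _ hAB)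
      have hA' : LinearIndependent K (fun i : Fin 2 => A i.succ) :=
        hA.comp Fin.succ (Fin.succ_injective _)
      rw [Fintype.linearIndependent_iff] at hA' ⊢
      intro g hg
      apply hA' g
      ext u
      have := congrFun hg (Fin.natAdd (n - k + 1) u)
      simpa [hzdef] using this
    · intro i
      rw [vecMul_iff n k hk f hf (s • x) (Polynomial.C (s : K) * q)
        ((Polynomial.natDegree_C_mul_le _ _).trans hq) (by
          intro i; rw [Polynomial.coeff_C_mul]; rfl), sum_rowP]
      have h1 : ∑ j : Fin (n - k + 1), Polynomial.C (z i (Fin.castAdd 3 j)) *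
          Polynomial.X ^ (j : ℕ) = - Polynomial.C ((s⁻¹ : Kˣ) : K) * b i := by
        have hd : (b i).natDegree < n - k + 1 := by
          fin_cases i
          · exact Nat.lt_succ_of_le hb1
          · exact Nat.lt_succ_of_le hb2
        conv_rhs => rw [Polynomial.as_sum_range_C_mul_X_pow' _ hd, Finset.mul_sum,
          Finset.sum_range]
        apply Finset.sum_congr rfl
        intro j _
        simp only [hzdef]
        rw [show Fin.castAdd 3 j = Fin.castAdd (m := 3) j from rfl, Fin.append_left]
        simp [mul_assoc]
      have h2 : ∑ u : Fin 3, Polynomial.C (z i (Fin.natAdd (n - k + 1) u)) * dehom f u =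
          q * b i := by
        have : ∀ u, z i (Fin.natAdd (n - k + 1) u) = A i.succ u := by
          intro u
          simp only [hzdef]
          rw [Fin.append_right]
        simp only [this]
        fin_cases i
        · exact hb1'
        · exact hb2'
      rw [h1, h2]
      have h3 : Polynomial.C ((s⁻¹ : Kˣ) : K) * Polynomial.C (s : K) = 1 := by
        rw [← Polynomial.C_mul]; simp
      linear_combination - (b i * q) * h3

theorem hom_scale {K : Type*} [Field K] {σ : Type*} [Fintype σ] {S : Type*} [CommRing S]
    [Algebra K S] (H : MvPolynomial σ K) (e : ℕ) (hH : H.IsHomogeneous e) (c : S) (a : σ → S) :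
    aeval (fun u => c * a u) H = c ^ e * aeval a H := by
  rw [aeval_def, aeval_def, eval₂_eq', eval₂_eq', Finset.mul_sum]
  apply Finset.sum_congr rfl
  intro d hd
  have h1 : ∑ i, d i = e := by
    have := hH (by simpa using hd)
    rw [Finsupp.weight_apply, Finsupp.sum_fintype _ _ (by simp)] at this
    simpa using this
  simp only [mul_pow, Finset.prod_mul_distrib, Finset.prod_pow_eq_pow_sum, h1]
  ring

theorem binary_zero {K : Type*} [Field K] (r : MvPolynomial (Fin 2) K) (e : ℕ)
    (hr : r.IsHomogeneous e) (h : aeval ![(1 : Polynomial K), Polynomial.X] r = 0) : r = 0 := by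
  ext d
  by_contra hd
  rw [coeff_zero] at hd
  have h1 : d 0 + d 1 = e := by
    have := hr hd
    rw [Finsupp.weight_apply, Finsupp.sum_fintype _ _ (by simp)] at this
    simpa using this
  have h2 := aux_coeff e r hr (d 1)
  rw [h, if_pos (by omega), Polynomial.coeff_zero] at h2
  apply hd
  rw [h2]
  congr 1
  ext j
  fin_cases j
  · simp; omega
  · simp

theorem root_const {K : Type*} [Field K] [IsAlgClosed K] {L : Type*} [Field L] [Algebra K L]
    (ρ : Polynomial K) (hρ : ρ ≠ 0) (y : L) (hy : Polynomial.aeval y ρ = 0) :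
    ∃ c : K, y = algebraMap K L c := by
  have hi : IsIntegral K y := IsAlgebraic.isIntegral (show IsAlgebraic K y from ⟨ρ, hρ, hy⟩)
  have h1 := IsAlgClosed.degree_eq_one_of_irreducible K (minpoly.irreducible hi)
  have h2 := minpoly.mem_range_of_degree_eq_one K y h1
  obtain ⟨c, hc⟩ := h2
  exact ⟨c, hc.symm⟩

theorem binary_form {K : Type*} [Field K] [IsAlgClosed K] (r : MvPolynomial (Fin 2) K) (e : ℕ)
    (hr : r.IsHomogeneous e) (a b : Polynomial K)
    (hab : ∀ α β : K, Polynomial.C α * a + Polynomial.C β * b = 0 → α = 0 ∧ β = 0)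
    (h : aeval ![a, b] r = 0) : r = 0 := by
  by_contra hr0
  have hρ : aeval ![(1 : Polynomial K), Polynomial.X] r ≠ 0 := fun h0 =>
    hr0 (binary_zero r e hr h0)
  have ha : a ≠ 0 := by
    rintro rfl
    have := hab 1 0 (by simp)
    simp at this
  let L := FractionRing (Polynomial K)
  let ι : Polynomial K →ₐ[K] L := IsScalarTower.toAlgHom K (Polynomial K) L
  have hι : Function.Injective ι := IsFractionRing.injective (Polynomial K) L
  have hιa : ι a ≠ 0 := by
    intro h0; exact ha (hι (by rw [h0, map_zero]))
  have h1 : aeval (fun u => ι a * ![1, ι b / ι a] u) r = 0 := by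
    have h2 : (fun u => ι a * ![1, ι b / ι a] u) = fun u => ι (![a, b] u) := by
      funext u
      fin_cases u
      · simp
      · change ι a * (ι b / ι a) = ι b
        rw [mul_comm]; exact div_mul_cancel₀ _ hιa
    rw [h2, ← comp_aeval_apply, h, map_zero]
  rw [hom_scale r e hr] at h1
  have h3 : aeval ![1, ι b / ι a] r = 0 := by
    rcases mul_eq_zero.mp h1 with h | h
    · exact absurd h (pow_ne_zero _ hιa)
    · exact h
  have h4 : Polynomial.aeval (ι b / ι a) (aeval ![(1 : Polynomial K), Polynomial.X] r) = 0 := by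
    rw [comp_aeval_apply, ← h3]
    congr 2
    funext u
    fin_cases u <;> simp
  obtain ⟨c, hc⟩ := root_const _ hρ _ h4
  have h5 : ι b = ι (Polynomial.C c * a) := by
    rw [map_mul]
    have : ι (Polynomial.C c) = algebraMap K L c := ι.commutes c
    rw [this, ← hc]
    exact (div_mul_cancel₀ _ hιa).symm
  have h6 := hι h5
  have := hab c (-1) (by rw [h6]; simp)
  simp at this

/-- Linear substitution. -/
def subst {K : Type*} [Field K] (M : Matrix (Fin 3) (Fin 3) K) :
    MvPolynomial (Fin 3) K →ₐ[K] MvPolynomial (Fin 3) K :=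
  aeval (fun u => ∑ j, C (M u j) * X j)

theorem subst_subst {K : Type*} [Field K] (M N : Matrix (Fin 3) (Fin 3) K) (h : M * N = 1)
    (F : MvPolynomial (Fin 3) K) : subst N (subst M F) = F := by
  have : (subst N).comp (subst M) = AlgHom.id K _ := by
    apply algHom_ext
    intro u
    have h1 : ∀ l, ∑ j, M u j * N j l = if u = l then 1 else 0 := by
      intro l
      rw [← Matrix.mul_apply, h, Matrix.one_apply]
    simp only [AlgHom.comp_apply, subst, aeval_X, map_sum, map_mul, algHom_C,
      MvPolynomial.algebraMap_eq, AlgHom.id_apply, Finset.mul_sum]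
    rw [Finset.sum_comm]
    simp only [← mul_assoc, ← C_mul, ← Finset.sum_mul, ← map_sum, h1]
    simp
  exact DFunLike.congr_fun this F

theorem subst_hom {K : Type*} [Field K] (M : Matrix (Fin 3) (Fin 3) K)
    (F : MvPolynomial (Fin 3) K) (n : ℕ) (hF : F.IsHomogeneous n) :
    (subst M F).IsHomogeneous n := by
  have := hF.aeval (n := 1) (fun u => ∑ j, C (M u j) * X j) (fun u =>
    IsHomogeneous.sum _ _ _ fun j _ => isHomogeneous_C_mul_X _ _)
  simpa [subst] using this

theorem aeval_subst {K : Type*} [Field K] {S : Type*} [CommRing S] [Algebra K S]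
    (M : Matrix (Fin 3) (Fin 3) K) (F : MvPolynomial (Fin 3) K) (a : Fin 3 → S) :
    aeval a (subst M F) = aeval (fun u => ∑ j, algebraMap K S (M u j) * a j) F := by
  rw [subst, comp_aeval_apply]
  congr 2
  funext u
  simp

theorem subst_irr {K : Type*} [Field K] (M N : Matrix (Fin 3) (Fin 3) K) (h : M * N = 1)
    (F : MvPolynomial (Fin 3) K) (hF : Irreducible F) : Irreducible (subst M F) := by
  have h' : N * M = 1 := mul_eq_one_comm.mp h
  let e : MvPolynomial (Fin 3) K ≃ₐ[K] MvPolynomial (Fin 3) K :=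
    AlgEquiv.ofAlgHom (subst M) (subst N) (AlgHom.ext (subst_subst N M h'))
      (AlgHom.ext (subst_subst M N h))
  exact (MulEquiv.irreducible_iff e.toMulEquiv).mpr hF

structure Core {K : Type*} [Field K] (n : ℕ) (a : Fin 3 → Polynomial K)
    (F : MvPolynomial (Fin 3) K) : Prop where
  deg : ∀ u, (a u).natDegree ≤ n
  irr : Irreducible F
  hom : F.IsHomogeneous n
  zero : aeval a F = 0
  inj : ∃ S : Set K, S.Finite ∧ ∀ τ ∉ S, ∀ τ' ∉ S, ∀ c : K,
    (∀ u, (a u).eval τ' = c * (a u).eval τ) → τ = τ'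

theorem Core.transport {K : Type*} [Field K] {n : ℕ} {a : Fin 3 → Polynomial K}
    {F : MvPolynomial (Fin 3) K} (h : Core n a F) (A B : Matrix (Fin 3) (Fin 3) K)
    (hAB : A * B = 1) :
    Core n (fun i => ∑ u, Polynomial.C (A i u) * a u) (subst B F) := by
  have hBA : B * A = 1 := mul_eq_one_comm.mp hAB
  have h1 : ∀ u l, ∑ j, B u j * A j l = if u = l then 1 else 0 := by
    intro u l
    rw [← Matrix.mul_apply, hBA, Matrix.one_apply]
  refine ⟨?_, subst_irr B A hBA F h.irr, subst_hom _ _ _ h.hom, ?_, ?_⟩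
  · intro i
    refine Polynomial.natDegree_sum_le_of_forall_le _ _ ?_
    intro u _
    exact (Polynomial.natDegree_C_mul_le _ _).trans (h.deg u)
  · rw [aeval_subst]
    have : (fun u => ∑ j, algebraMap K (Polynomial K) (B u j) *
        ∑ u, Polynomial.C (A j u) * a u) = a := by
      funext u
      simp only [Polynomial.algebraMap_eq, Finset.mul_sum]
      rw [Finset.sum_comm]
      simp only [← mul_assoc, ← Polynomial.C_mul, ← Finset.sum_mul, ← map_sum, h1]
      simp
    rw [this, h.zero]
  · obtain ⟨S, hS, hi⟩ := h.inj
    refine ⟨S, hS, fun τ hτ τ' hτ' c hc => hi τ hτ τ' hτ' c ?_⟩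
    have key : ∀ (σ : K) u, (a u).eval σ = ∑ j, B u j *
        (∑ l, Polynomial.C (A j l) * a l).eval σ := by
      intro σ u
      simp only [Polynomial.eval_finsetSum, Polynomial.eval_mul, Polynomial.eval_C, Finset.mul_sum]
      rw [Finset.sum_comm]
      simp only [← mul_assoc, ← Finset.sum_mul, h1]
      simp
    intro u
    rw [key, key]
    simp only [hc, Finset.mul_sum]
    apply Finset.sum_congr rfl
    intro j _
    ring

theorem extend_one {K : Type*} [Field K] {m : ℕ} (hm : m < 3) (c : Fin m → Fin 3 → K)
    (hc : LinearIndependent K c) :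
    ∃ v : Fin 3 → K, LinearIndependent K (Fin.cons v c : Fin (m + 1) → Fin 3 → K) := by
  obtain ⟨v, hv⟩ : ∃ v : Fin 3 → K, v ∉ Submodule.span K (Set.range c) := by
    by_contra h
    push Not at h
    have h1 : Submodule.span K (Set.range c) = ⊤ := by
      rw [eq_top_iff]; intro x _; exact h x
    have h2 := finrank_span_eq_card hc
    rw [h1] at h2
    simp at h2
    omega
  exact ⟨v, hc.finCons hv⟩

theorem aux_first {K : Type*} [Field K] (c : Fin 3 → K) (hc : c ≠ 0) :
    ∃ A B : Matrix (Fin 3) (Fin 3) K, A * B = 1 ∧ A 0 = c := by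
  have h0 : LinearIndependent K (fun _ : Fin 1 => c) := by
    rw [linearIndependent_unique_iff]; exact hc
  obtain ⟨v, hv⟩ := extend_one (by norm_num) _ h0
  obtain ⟨w, hw⟩ := extend_one (by norm_num) _ hv
  have hl : LinearIndependent K (Matrix.row (Matrix.of ![c, v, w])) := by
    have hl := hw.comp Fin.rev Fin.rev_injective
    convert hl using 1
    funext i
    fin_cases i <;> rfl
  have hu := Matrix.linearIndependent_rows_iff_isUnit.mp hl
  obtain ⟨B, hB⟩ := hu.exists_right_inv
  exact ⟨_, B, hB, rfl⟩

theorem aeval_finSucc {K : Type*} [Field K] {S : Type*} [CommRing S] [Algebra K S]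
    (G : MvPolynomial (Fin 3) K) (y : Fin 3 → S) :
    aeval y G = (finSuccEquiv K 2 G).eval₂
      ((aeval ![y 1, y 2] : MvPolynomial (Fin 2) K →ₐ[K] S) : MvPolynomial (Fin 2) K →+* S)
      (y 0) := by
  induction G using MvPolynomial.induction_on with
  | C r =>
    have h1 : finSuccEquiv K 2 (C r) = Polynomial.C (C r) := by
      simp [finSuccEquiv_apply]
    rw [h1]; simp
  | add p q hp hq => rw [map_add, map_add, Polynomial.eval₂_add, hp, hq]
  | mul_X p i hp =>
    rw [map_mul, map_mul, Polynomial.eval₂_mul, hp, aeval_X]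
    congr 1
    refine Fin.cases ?_ (fun j => ?_) i
    · rw [finSuccEquiv_X_zero]; simp
    · rw [finSuccEquiv_X_succ]
      fin_cases j <;> simp

/-- A nondegenerate curve is not contained in the line `w₀ = 0`. -/
theorem Core.ne_zero {K : Type*} [Field K] [IsAlgClosed K] {n : ℕ} (hn : 3 ≤ n)
    {a : Fin 3 → Polynomial K}
    {F : MvPolynomial (Fin 3) K} (h : Core n a F) : a 0 ≠ 0 := by
  intro h0
  set P := finSuccEquiv K 2 F with hP
  have hPirr : Irreducible P := (MulEquiv.irreducible_iff (finSuccEquiv K 2).toMulEquiv).mpr h.irr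
  have hr : (P.coeff 0).IsHomogeneous n := h.hom.finSuccEquiv_coeff_isHomogeneous 0 n (by simp)
  have hr0 : P.coeff 0 ≠ 0 := by
    intro hz
    obtain ⟨Q, hQ⟩ := Polynomial.X_dvd_iff.mpr hz
    rcases hPirr.isUnit_or_isUnit hQ with hu | hu
    · exact Polynomial.not_isUnit_X hu
    · obtain ⟨G, rfl⟩ := (finSuccEquiv K 2).surjective Q
      have hF : F = X 0 * G := by
        apply (finSuccEquiv K 2).injective
        rw [← hP, hQ, map_mul, finSuccEquiv_X_zero]
      have hG : IsUnit G := (MulEquiv.isUnit_map (finSuccEquiv K 2).toMulEquiv).mp hu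
      rw [MvPolynomial.isUnit_iff_eq_C_of_isReduced] at hG
      obtain ⟨r, hr, rfl⟩ := hG
      have hF1 : F.IsHomogeneous 1 := by
        rw [hF, mul_comm]; exact isHomogeneous_C_mul_X _ _
      have := hF1.inj_right h.hom h.irr.ne_zero
      omega
  have hev : aeval ![a 1, a 2] (P.coeff 0) = 0 := by
    have hz := h.zero
    rw [aeval_finSucc, h0, Polynomial.eval₂_at_zero] at hz
    exact hz
  by_cases hab : ∀ α β : K, Polynomial.C α * a 1 + Polynomial.C β * a 2 = 0 → α = 0 ∧ β = 0
  · exact hr0 (binary_form _ n hr _ _ hab hev)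
  · push Not at hab
    obtain ⟨α, β, h1, h2⟩ := hab
    obtain ⟨S, hS, hi⟩ := h.inj
    have hinf : (Sᶜ : Set K).Infinite := hS.infinite_compl
    obtain ⟨τ, hτ⟩ := hinf.nonempty
    obtain ⟨τ', hτ', hne⟩ := hinf.exists_notMem_finite (Set.finite_singleton τ)
    apply hne
    rw [Set.mem_singleton_iff]
    have e0 : ∀ σ, (a 0).eval σ = 0 := by intro σ; rw [h0]; simp
    have e1 : ∀ σ, α * (a 1).eval σ + β * (a 2).eval σ = 0 := by
      intro σ
      have := congrArg (Polynomial.eval σ) h1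
      simpa using this
    by_cases hα : α = 0
    · have hβ := h2 hα
      have e2 : ∀ σ, (a 2).eval σ = 0 := by
        intro σ
        have := e1 σ
        simpa [hα, hβ] using this
      by_cases hz : (a 1).eval τ = 0
      · apply hi τ' hτ' τ hτ 0
        intro u; fin_cases u <;> simp [e0, e2, hz]
      · symm
        apply hi τ hτ τ' hτ' ((a 1).eval τ' / (a 1).eval τ)
        intro u; fin_cases u
        · simp [e0]
        · simp [hz]
        · simp [e2]
    · have e2 : ∀ σ, (a 1).eval σ = (-β / α) * (a 2).eval σ := by
        intro σ
        have := e1 σ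
        field_simp
        linear_combination this
      by_cases hz : (a 2).eval τ = 0
      · apply hi τ' hτ' τ hτ 0
        intro u; fin_cases u <;> simp [e0, e2, hz]
      · symm
        apply hi τ hτ τ' hτ' ((a 2).eval τ' / (a 2).eval τ)
        intro u; fin_cases u
        · simp [e0]
        · simp [e2]; field_simp
        · simp [hz]

theorem Core.indep {K : Type*} [Field K] [IsAlgClosed K] {n : ℕ} (hn : 3 ≤ n)
    {a : Fin 3 → Polynomial K}
    {F : MvPolynomial (Fin 3) K} (h : Core n a F) (α β : K)
    (hαβ : Polynomial.C α * a 1 + Polynomial.C β * a 2 = 0) : α = 0 ∧ β = 0 := by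
  by_contra hne
  have hc : ![0, α, β] ≠ 0 := by
    intro h0
    apply hne
    exact ⟨congrFun h0 1, congrFun h0 2⟩
  obtain ⟨A, B, hAB, hA⟩ := aux_first _ hc
  apply (h.transport A B hAB).ne_zero hn
  simpa [Fin.sum_univ_three, hA] using hαβ

/-- Polynomials all of whose monomials have degree at least `m` in `w₁, w₂`. -/
def Jideal (K : Type*) [Field K] (m : ℕ) : Ideal (MvPolynomial (Fin 3) K) where
  carrier := { F | ∀ d ∈ F.support, m ≤ d 1 + d 2 }
  zero_mem' := by simp
  add_mem' := by
    intro F G hF hG d hd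
    rcases Finset.mem_union.mp (support_add hd) with h | h
    · exact hF d h
    · exact hG d h
  smul_mem' := by
    classical
    intro c F hF d hd
    obtain ⟨x, hx, y, hy, rfl⟩ := Finset.mem_add.mp (support_mul _ _ hd)
    have := hF y hy
    simp only [Finsupp.add_apply]
    omega

theorem pointIdeal_le_J {K : Type*} [Field K] :
    pointIdeal (![1, 0, 0] : Fin 3 → K) ≤ Jideal K 1 := by
  rw [pointIdeal, Ideal.span_le]
  rintro L ⟨hL, hL0⟩ d hd
  by_contra hlt
  have h1 : ∀ d ∈ L.support, d 0 + d 1 + d 2 = 1 := by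
    intro d hd
    have := hL (by simpa using hd)
    rw [Finsupp.weight_apply, Finsupp.sum_fintype _ _ (by simp)] at this
    simpa [Fin.sum_univ_three] using this
  rw [eval_eq', Finset.sum_eq_single d] at hL0
  · have hd1 : d 1 = 0 := by omega
    have hd2 : d 2 = 0 := by omega
    simp [Fin.prod_univ_three, hd1, hd2] at hL0
    simp [hL0] at hd
  · intro b hb hne
    have hb1 := h1 b hb
    have hd1 := h1 d hd
    have : b 1 ≠ 0 ∨ b 2 ≠ 0 := by
      by_contra hc
      push Not at hc
      apply hne
      ext j
      fin_cases j <;> simp <;> omega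
    rcases this with h | h <;> simp [Fin.prod_univ_three, h]
  · intro h; exact absurd hd h

theorem pow_le_J {K : Type*} [Field K] (m : ℕ) :
    pointIdeal (![1, 0, 0] : Fin 3 → K) ^ m ≤ Jideal K m := by
  classical
  induction m with
  | zero => intro F _ d _; omega
  | succ m ih =>
    rw [pow_succ, Ideal.mul_le]
    intro F hF G hG d hd
    obtain ⟨x, hx, y, hy, rfl⟩ := Finset.mem_add.mp (support_mul _ _ hd)
    have h1 := ih hF x hx
    have h2 := pointIdeal_le_J hG y hy
    simp only [Finsupp.add_apply]
    omega

theorem J_le_pow {K : Type*} [Field K] (m : ℕ) :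
    Jideal K m ≤ pointIdeal (![1, 0, 0] : Fin 3 → K) ^ m := by
  intro F hF
  rw [F.as_sum]
  apply Ideal.sum_mem
  intro d hd
  have h1 : (X 1 : MvPolynomial (Fin 3) K) ∈ pointIdeal (![1, 0, 0] : Fin 3 → K) :=
    Ideal.subset_span ⟨isHomogeneous_X _ _, by simp⟩
  have h2 : (X 2 : MvPolynomial (Fin 3) K) ∈ pointIdeal (![1, 0, 0] : Fin 3 → K) :=
    Ideal.subset_span ⟨isHomogeneous_X _ _, by simp⟩
  rw [monomial_eq, Finsupp.prod_fintype _ _ (by simp), Fin.prod_univ_three, mul_assoc (X 0 ^ _)]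
  apply Ideal.mul_mem_left
  apply Ideal.mul_mem_left
  apply Ideal.pow_le_pow_right (hF d hd)
  rw [pow_add]
  exact Ideal.mul_mem_mul (Ideal.pow_mem_pow h1 _) (Ideal.pow_mem_pow h2 _)

theorem subst_mem {K : Type*} [Field K] (B : Matrix (Fin 3) (Fin 3) K) (p p' : Fin 3 → K)
    (hp : B.mulVec p' = p) (m : ℕ) (F : MvPolynomial (Fin 3) K) (hF : F ∈ pointIdeal p ^ m) :
    subst B F ∈ pointIdeal p' ^ m := by
  have h1 : Ideal.map (subst B) (pointIdeal p) ≤ pointIdeal p' := by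
    rw [pointIdeal, Ideal.map_span, Ideal.span_le]
    rintro _ ⟨L, ⟨hL, hL0⟩, rfl⟩
    refine Ideal.subset_span ⟨subst_hom _ _ _ hL, ?_⟩
    have := aeval_subst B L p'
    rw [← hL0, ← hp]
    simp only [aeval_eq_eval] at this
    exact this
  have h2 := Ideal.mem_map_of_mem (subst B) hF
  rw [Ideal.map_pow] at h2
  exact Ideal.pow_right_mono h1 m h2

theorem mem_iff {K : Type*} [Field K] (A B : Matrix (Fin 3) (Fin 3) K) (hAB : A * B = 1)
    (p : Fin 3 → K) (hp : B.mulVec ![1, 0, 0] = p) (m : ℕ) (F : MvPolynomial (Fin 3) K) :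
    F ∈ pointIdeal p ^ m ↔ ∀ d ∈ (subst B F).support, m ≤ d 1 + d 2 := by
  have hBA : B * A = 1 := mul_eq_one_comm.mp hAB
  constructor
  · intro h
    exact pow_le_J m (subst_mem B p _ hp m F h)
  · intro h
    have h1 : subst B F ∈ pointIdeal (![1, 0, 0] : Fin 3 → K) ^ m := J_le_pow m h
    have h2 := subst_mem A _ p (by rw [← hp, Matrix.mulVec_mulVec, hAB, Matrix.one_mulVec]) m _ h1
    rwa [subst_subst B A hBA] at h2

theorem multAt_iff {K : Type*} [Field K] (A B : Matrix (Fin 3) (Fin 3) K) (hAB : A * B = 1)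
    (p : Fin 3 → K) (hp : B.mulVec ![1, 0, 0] = p) (k n : ℕ) (hk : 1 ≤ k)
    (F : MvPolynomial (Fin 3) K) (hF : F ≠ 0) (hhom : F.IsHomogeneous n) :
    k ≤ multAt F p ↔ ∀ d ∈ (subst B F).support, k ≤ d 1 + d 2 := by
  have hBA : B * A = 1 := mul_eq_one_comm.mp hAB
  have hF' : subst B F ≠ 0 := by
    intro h
    apply hF
    rw [← subst_subst B A hBA F, h, map_zero]
  have hbdd : BddAbove { m | F ∈ pointIdeal p ^ m } := by
    refine ⟨n, ?_⟩
    intro m hm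
    rw [Set.mem_ofPred_eq, mem_iff A B hAB p hp] at hm
    obtain ⟨d, hd⟩ := support_nonempty.mpr hF'
    have h1 := hm d hd
    have := subst_hom B F n hhom (by simpa using hd)
    rw [Finsupp.weight_apply, Finsupp.sum_fintype _ _ (by simp)] at this
    simp [Fin.sum_univ_three] at this
    omega
  rw [← mem_iff A B hAB p hp]
  constructor
  · intro h
    have h1 : sSup { m | F ∈ pointIdeal p ^ m } ∈ { m | F ∈ pointIdeal p ^ m } :=
      Nat.sSup_mem ⟨0, by simp⟩ hbdd
    exact Ideal.pow_le_pow_right h h1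
  · intro h
    exact le_csSup hbdd h

theorem natDegree_iff {K : Type*} [Field K] (n k : ℕ) (hk : k ≤ n)
    (F : MvPolynomial (Fin 3) K) (hhom : F.IsHomogeneous n) :
    (∀ d ∈ F.support, k ≤ d 1 + d 2) ↔ (finSuccEquiv K 2 F).natDegree ≤ n - k := by
  rw [natDegree_finSuccEquiv, degreeOf_le_iff]
  have h1 : ∀ d ∈ F.support, d 0 + d 1 + d 2 = n := by
    intro d hd
    have := hhom (by simpa using hd)
    rw [Finsupp.weight_apply, Finsupp.sum_fintype _ _ (by simp)] at this
    simpa [Fin.sum_univ_three] using this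
  constructor
  · intro h d hd
    have := h d hd
    have := h1 d hd
    omega
  · intro h d hd
    have := h d hd
    have := h1 d hd
    omega

def Good {K : Type*} [Field K] (n k : ℕ) (a : Fin 3 → Polynomial K) : Prop :=
  ∃ q : Polynomial K, q ≠ 0 ∧ q.natDegree ≤ k ∧ ∀ i : Fin 3, i ≠ 0 →
    ∃ b : Polynomial K, b.natDegree ≤ n - k ∧ a i = q * b

/-- Evaluation at constants. -/
theorem aeval_C_comp {K : Type*} [Field K] {σ : Type*} (g : σ → Polynomial K)
    (r : MvPolynomial σ K) :
    aeval (fun u => (Polynomial.C (g u) : Polynomial (Polynomial K))) r =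
      Polynomial.C (aeval g r) := by
  induction r using MvPolynomial.induction_on with
  | C c =>
    rw [aeval_C, aeval_C, Polynomial.algebraMap_apply]
  | add p q hp hq => rw [map_add, map_add, map_add, hp, hq]
  | mul_X p i hp => rw [map_mul, map_mul, map_mul, hp, aeval_X, aeval_X]

/-- Injectivity of `w₁ ↦ T a₁, w₂ ↦ T a₂`. -/
theorem two_inj {K : Type*} [Field K] [IsAlgClosed K] (a b : Polynomial K)
    (hab : ∀ α β : K, Polynomial.C α * a + Polynomial.C β * b = 0 → α = 0 ∧ β = 0)
    (r : MvPolynomial (Fin 2) K)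
    (h : aeval (fun u => (Polynomial.X : Polynomial (Polynomial K)) *
      Polynomial.C (![a, b] u)) r = 0) : r = 0 := by
  have hcomp : ∀ i, aeval (fun u => (Polynomial.X : Polynomial (Polynomial K)) *
      Polynomial.C (![a, b] u)) (homogeneousComponent i r) =
      Polynomial.C (aeval ![a, b] (homogeneousComponent i r)) * Polynomial.X ^ i := by
    intro i
    rw [hom_scale _ i (homogeneousComponent_isHomogeneous i r), mul_comm,
      aeval_C_comp ![a, b] (homogeneousComponent i r)]
  have hz : ∀ i ∈ Finset.range (r.totalDegree + 1), homogeneousComponent i r = 0 := by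
    intro i hi
    apply binary_form _ i (homogeneousComponent_isHomogeneous i r) a b hab
    rw [← sum_homogeneousComponent r, map_sum] at h
    simp only [hcomp] at h
    have h2 := congrArg (fun p => Polynomial.coeff p i) h
    simp only [Polynomial.finsetSum_coeff, Polynomial.coeff_C_mul, Polynomial.coeff_X_pow,
      Polynomial.coeff_zero, mul_ite, mul_one, mul_zero, Finset.sum_ite_eq] at h2
    rw [if_pos hi] at h2
    exact h2
  rw [← sum_homogeneousComponent r]
  exact Finset.sum_eq_zero hz

theorem exists_H {K : Type*} [Field K] (n k : ℕ) (hk : k ≤ n) (a : Fin 3 → Polynomial K)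
    (ha : (a 0).natDegree ≤ n) (hg : Good n k a) :
    ∃ (H : MvPolynomial (Fin 3) K) (e : ℕ), H ≠ 0 ∧ H.IsHomogeneous e ∧
      (finSuccEquiv K 2 H).natDegree ≤ n - k ∧ aeval a H = 0 := by
  obtain ⟨q, hq0, hq, hb⟩ := hg
  obtain ⟨b1, hb1, e1⟩ := hb 1 (by decide)
  obtain ⟨b2, hb2, e2⟩ := hb 2 (by decide)
  set m := n - k with hm
  set M := n * m + m * m + 2 with hM
  set D := n * m + m * (m + M) + 1 with hD
  let ι := Fin (m + 1) × Fin M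
  let v : ι → Polynomial K := fun x => a 0 ^ (x.1 : ℕ) * q ^ (m - (x.1 : ℕ)) * b1 ^ (x.2 : ℕ) *
    b2 ^ ((m - (x.1 : ℕ)) + (M - 1 - (x.2 : ℕ)))
  have hv : ∀ x, v x ∈ Polynomial.degreeLT K D := by
    rintro ⟨i, j⟩
    rw [Polynomial.mem_degreeLT]
    refine lt_of_le_of_lt Polynomial.degree_le_natDegree ?_
    norm_cast
    have hi : (i : ℕ) ≤ m := by omega
    have hj : (j : ℕ) ≤ M - 1 := by omega
    obtain ⟨i', hi'⟩ := Nat.exists_eq_add_of_le hi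
    obtain ⟨j', hj'⟩ := Nat.exists_eq_add_of_le hj
    have s1 : (a 0 ^ (i : ℕ)).natDegree ≤ i * n :=
      Polynomial.natDegree_pow_le.trans (Nat.mul_le_mul_left _ ha)
    have s2 : (q ^ (m - (i : ℕ))).natDegree ≤ i' * n :=
      Polynomial.natDegree_pow_le.trans (Nat.mul_le_mul (by omega) (hq.trans hk))
    have s3 : (b1 ^ (j : ℕ)).natDegree ≤ j * m :=
      Polynomial.natDegree_pow_le.trans (Nat.mul_le_mul_left _ hb1)
    have s4 : (b2 ^ ((m - (i : ℕ)) + (M - 1 - (j : ℕ)))).natDegree ≤ (m + j') * m :=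
      Polynomial.natDegree_pow_le.trans (Nat.mul_le_mul (by omega) hb2)
    have t1 := Polynomial.natDegree_mul_le (p := a 0 ^ (i : ℕ)) (q := q ^ (m - (i : ℕ)))
    have t2 := Polynomial.natDegree_mul_le (p := a 0 ^ (i : ℕ) * q ^ (m - (i : ℕ)))
      (q := b1 ^ (j : ℕ))
    have t3 := Polynomial.natDegree_mul_le (p := a 0 ^ (i : ℕ) * q ^ (m - (i : ℕ)) * b1 ^ (j : ℕ))
      (q := b2 ^ ((m - (i : ℕ)) + (M - 1 - (j : ℕ))))
    have u1 : (i : ℕ) * n + i' * n = n * m := by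
      calc (i : ℕ) * n + i' * n = n * (i + i') := by ring
        _ = n * m := by rw [← hi']
    have u2 : (j : ℕ) * m + (m + j') * m ≤ m * (m + M) := by
      have : (j : ℕ) + j' ≤ M := by omega
      nlinarith
    change (a 0 ^ (i : ℕ) * q ^ (m - (i : ℕ)) * b1 ^ (j : ℕ) *
      b2 ^ ((m - (i : ℕ)) + (M - 1 - (j : ℕ)))).natDegree < D
    omega
  have hdep : ¬ LinearIndependent K (fun x => (⟨v x, hv x⟩ : Polynomial.degreeLT K D)) := by
    intro hl
    have h1 := hl.fintype_card_le_finrank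
    rw [(Polynomial.degreeLTEquiv K D).finrank_eq] at h1
    simp [ι] at h1
    rw [hD] at h1
    have : (m + 1) * M = m * M + M := by ring
    have : m * (m + M) = m * m + m * M := by ring
    omega
  rw [Fintype.not_linearIndependent_iff] at hdep
  obtain ⟨h, hsum, x0, hx0⟩ := hdep
  have hsum' : ∑ x, Polynomial.C (h x) * v x = 0 := by
    have := congrArg (Submodule.subtype _) hsum
    simpa [Polynomial.smul_eq_C_mul] using this
  let d : ι → (Fin 3 →₀ ℕ) := fun x => Finsupp.equivFunOnFinite.symm
    ![(x.1 : ℕ), (x.2 : ℕ), (m - (x.1 : ℕ)) + (M - 1 - (x.2 : ℕ))]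
  have hd0 : ∀ x, d x 0 = x.1 := fun x => rfl
  have hd1 : ∀ x, d x 1 = x.2 := fun x => rfl
  have hd2 : ∀ x, d x 2 = (m - (x.1 : ℕ)) + (M - 1 - (x.2 : ℕ)) := fun x => rfl
  have hdinj : ∀ x y, d x = d y → x = y := by
    intro x y hxy
    have e0 := DFunLike.congr_fun hxy 0
    have e1 := DFunLike.congr_fun hxy 1
    rw [hd0, hd0] at e0
    rw [hd1, hd1] at e1
    exact Prod.ext (Fin.ext e0) (Fin.ext e1)
  refine ⟨∑ x, monomial (d x) (h x), m + (M - 1), ?_, ?_, ?_, ?_⟩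
  · intro h0
    have := congrArg (coeff (d x0)) h0
    rw [coeff_sum, Finset.sum_eq_single x0] at this
    · simp at this; exact hx0 this
    · intro y _ hy
      rw [coeff_monomial, if_neg]
      intro hc; exact hy (hdinj _ _ hc)
    · simp
  · apply IsHomogeneous.sum
    intro x _
    apply isHomogeneous_monomial
    rw [Finsupp.degree_eq_sum, Fin.sum_univ_three, hd0, hd1, hd2]
    have := x.1.isLt
    have := x.2.isLt
    omega
  · rw [natDegree_finSuccEquiv]
    refine (degreeOf_sum_le _ _ _).trans ?_
    apply Finset.sup_le
    intro x _
    rw [degreeOf_le_iff]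
    intro y hy
    have hy' := Finset.mem_singleton.mp (support_monomial_subset hy)
    rw [hy', hd0]
    have := x.1.isLt
    omega
  · rw [map_sum]
    have : ∀ x : ι, aeval a (monomial (d x) (h x)) =
        q ^ (M - 1) * (Polynomial.C (h x) * v x) := by
      intro x
      rw [aeval_monomial, Finsupp.prod_fintype _ _ (by simp), Fin.prod_univ_three, hd0, hd1, hd2,
        e1, e2]
      simp only [v, mul_pow, Polynomial.algebraMap_eq]
      have hx : (x.2 : ℕ) + (m - (x.1 : ℕ) + (M - 1 - (x.2 : ℕ))) = (m - (x.1 : ℕ)) + (M - 1) := by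
        have := x.2.isLt
        omega
      have hq : q ^ (x.2 : ℕ) * q ^ (m - (x.1 : ℕ) + (M - 1 - (x.2 : ℕ))) =
          q ^ (m - (x.1 : ℕ)) * q ^ (M - 1) := by
        rw [← pow_add, ← pow_add, hx]
      linear_combination (Polynomial.C (h x) * a 0 ^ (x.1 : ℕ) * b1 ^ (x.2 : ℕ) *
        b2 ^ (m - (x.1 : ℕ) + (M - 1 - (x.2 : ℕ)))) * hq
    simp only [this]
    rw [← Finset.mul_sum, hsum', mul_zero]

/-- An irreducible polynomial over a unique factorization domain has minimal degree among the
nonzero polynomials having a common root with it. -/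
theorem min_degree_aux {R S : Type*} (E L : Type*) [CommRing R] [IsDomain R] [UniqueFactorizationMonoid R]
    [CommRing S] [IsDomain S] [Field E] [Algebra R E] [IsFractionRing R E]
    [Field L] [Algebra S L] [IsFractionRing S L] (φ : R →+* S) (hφ : Function.Injective φ) (y : S)
    (P H : Polynomial R) (hP : Irreducible P) (hH : H ≠ 0) (hPy : P.eval₂ φ y = 0)
    (hHy : H.eval₂ φ y = 0) : P.natDegree ≤ H.natDegree := by
  by_contra hlt
  push Not at hlt
  have hφL : Function.Injective ((algebraMap S L).comp φ) :=
    (IsFractionRing.injective S L).comp hφ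
  obtain ⟨ψ, hψ⟩ : ∃ ψ : E →+* L,
      ψ.comp (algebraMap R E) = (algebraMap S L).comp φ :=
    ⟨IsFractionRing.lift hφL, RingHom.ext fun x => IsFractionRing.lift_algebraMap hφL x⟩
  have hzero : ∀ G : Polynomial R, G.eval₂ φ y = 0 →
      (G.map (algebraMap R E)).eval₂ ψ (algebraMap S L y) = 0 := by
    intro G hG
    rw [Polynomial.eval₂_map, hψ, ← Polynomial.hom_eval₂, hG, map_zero]
  have hprim : P.IsPrimitive := hP.isPrimitive (by omega)
  have hPE : Irreducible (P.map (algebraMap R E)) :=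
    (hprim.irreducible_iff_irreducible_map_fraction_map).mp hP
  have hinj : Function.Injective (algebraMap R E) :=
    IsFractionRing.injective R E
  have hnd : ¬ P.map (algebraMap R E) ∣
      H.map (algebraMap R E) := by
    intro hd
    have h1 := Polynomial.natDegree_le_of_dvd hd (by
      rw [Ne, Polynomial.map_eq_zero_iff hinj]
      exact hH)
    rw [Polynomial.natDegree_map_eq_of_injective hinj,
      Polynomial.natDegree_map_eq_of_injective hinj] at h1
    omega
  obtain ⟨s, t, hst⟩ := hPE.coprime_iff_not_dvd.mpr hnd
  have := congrArg (Polynomial.eval₂ ψ (algebraMap S L y)) hst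
  rw [Polynomial.eval₂_add, Polynomial.eval₂_mul, Polynomial.eval₂_mul, hzero P hPy,
    hzero H hHy] at this
  simp at this

theorem min_degree {R S : Type*} [CommRing R] [IsDomain R] [UniqueFactorizationMonoid R]
    [CommRing S] [IsDomain S] (φ : R →+* S) (hφ : Function.Injective φ) (y : S)
    (P H : Polynomial R) (hP : Irreducible P) (hH : H ≠ 0) (hPy : P.eval₂ φ y = 0)
    (hHy : H.eval₂ φ y = 0) : P.natDegree ≤ H.natDegree :=
  min_degree_aux (FractionRing R) (FractionRing S) φ hφ y P H hP hH hPy hHy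

theorem dir1 {K : Type*} [Field K] [IsAlgClosed K] {n : ℕ} (hn : 3 ≤ n) (k : ℕ) (hk : k ≤ n)
    {a : Fin 3 → Polynomial K} {F : MvPolynomial (Fin 3) K} (h : Core n a F)
    (hg : Good n k a) : (finSuccEquiv K 2 F).natDegree ≤ n - k := by
  obtain ⟨H, e, hH0, hHhom, hHdeg, hHz⟩ := exists_H n k hk a (h.deg 0) hg
  refine le_trans ?_ hHdeg
  obtain ⟨y, hy⟩ : ∃ y : Fin 3 → Polynomial (Polynomial K),
      ∀ u, y u = Polynomial.X * Polynomial.C (a u) := ⟨_, fun u => rfl⟩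
  have hφ : Function.Injective ((aeval ![y 1, y 2] :
      MvPolynomial (Fin 2) K →ₐ[K] Polynomial (Polynomial K)) :
      MvPolynomial (Fin 2) K →+* Polynomial (Polynomial K)) := by
    rw [injective_iff_map_eq_zero]
    intro r hr
    apply two_inj (a 1) (a 2) (fun α β => h.indep hn α β)
    have hfun : (fun u => (Polynomial.X : Polynomial (Polynomial K)) *
        Polynomial.C (![a 1, a 2] u)) = ![y 1, y 2] := by
      funext u
      fin_cases u
      · exact (hy 1).symm
      · exact (hy 2).symm
    rw [hfun]
    exact hr
  have hzero : ∀ (G : MvPolynomial (Fin 3) K) (e : ℕ), G.IsHomogeneous e → aeval a G = 0 →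
      (finSuccEquiv K 2 G).eval₂ ((aeval ![y 1, y 2] :
        MvPolynomial (Fin 2) K →ₐ[K] Polynomial (Polynomial K)) :
        MvPolynomial (Fin 2) K →+* Polynomial (Polynomial K)) (y 0) = 0 := by
    intro G e hG hGa
    rw [← aeval_finSucc, funext hy, hom_scale G e hG, aeval_C_comp, hGa, map_zero, mul_zero]
  have hP : Irreducible (finSuccEquiv K 2 F) :=
    (MulEquiv.irreducible_iff (finSuccEquiv K 2).toMulEquiv).mpr h.irr
  have hH : finSuccEquiv K 2 H ≠ 0 := by
    simpa using hH0
  exact min_degree _ hφ (y 0) _ _ hP hH (hzero F n h.hom h.zero) (hzero H e hHhom hHz)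

theorem exists_factor {K : Type*} [Field K] [IsAlgClosed K] (g : Polynomial K) (hg : g ≠ 0)
    (j : ℕ) (hj : j ≤ g.natDegree) : ∃ h r : Polynomial K, g = h * r ∧ h.natDegree = j := by
  induction j with
  | zero => exact ⟨1, g, by simp, by simp⟩
  | succ j ih =>
    obtain ⟨h, r, hgr, hh⟩ := ih (by omega)
    have hh0 : h ≠ 0 := by rintro rfl; simp at hgr; exact hg hgr
    have hr0 : r ≠ 0 := by rintro rfl; simp at hgr; exact hg hgr
    have hdeg : g.natDegree = h.natDegree + r.natDegree := by
      rw [hgr, Polynomial.natDegree_mul hh0 hr0]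
    obtain ⟨c, hc⟩ := IsAlgClosed.exists_root r (by
      intro h0
      have := Polynomial.natDegree_eq_zero_iff_degree_le_zero.mpr h0.le
      omega)
    obtain ⟨r', hr'⟩ := Polynomial.dvd_iff_isRoot.mpr hc
    refine ⟨h * (Polynomial.X - Polynomial.C c), r', ?_, ?_⟩
    · rw [hgr, hr', mul_assoc]
    · rw [Polynomial.natDegree_mul hh0 (Polynomial.X_sub_C_ne_zero c), Polynomial.natDegree_X_sub_C, hh]

theorem count {K : Type*} [Field K] [IsAlgClosed K] [CharZero K] {n : ℕ} (hn : 3 ≤ n)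
    {a : Fin 3 → Polynomial K} {F : MvPolynomial (Fin 3) K} (h : Core n a F)
    (g b1 b2 : Polynomial K) (hg : g ≠ 0) (e1 : a 1 = g * b1) (e2 : a 2 = g * b2)
    (hco : IsCoprime b1 b2) :
    max b1.natDegree b2.natDegree ≤ (finSuccEquiv K 2 F).natDegree := by
  classical
  set P := finSuccEquiv K 2 F with hP
  have hP0 : P ≠ 0 := by
    simpa [hP] using h.irr.ne_zero
  set N := max b1.natDegree b2.natDegree with hN
  have hind := h.indep hn
  have hb2 : b2 ≠ 0 := by
    intro h0
    have := hind 0 1 (by rw [e2, h0]; simp)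
    simp at this
  have hW : Polynomial.wronskian b1 b2 ≠ 0 := by
    intro hW
    obtain ⟨d1, d2⟩ := hco.wronskian_eq_zero_iff.mp hW
    have c1 := Polynomial.eq_C_of_natDegree_eq_zero (Polynomial.derivative_eq_zero.mp d1)
    have c2 := Polynomial.eq_C_of_natDegree_eq_zero (Polynomial.derivative_eq_zero.mp d2)
    have := hind (b2.coeff 0) (-b1.coeff 0) (by
      rw [e1, e2, c1, c2]; simp; ring)
    apply hb2
    rw [c2, this.1, map_zero]
  obtain ⟨S, hS, hinj⟩ := h.inj
  set T : Set K := S ∪ (g * Polynomial.wronskian b1 b2).roots.toFinset with hT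
  have hTfin : T.Finite := hS.union (Finset.finite_toSet _)
  have hlc : (P.leadingCoeff).IsHomogeneous (n - P.natDegree) := by
    have hle : P.natDegree ≤ n := by
      rw [hP, natDegree_finSuccEquiv]
      exact (degreeOf_le_totalDegree _ _).trans h.hom.totalDegree_le
    exact h.hom.finSuccEquiv_coeff_isHomogeneous P.natDegree _ (by omega)
  set ρ : Polynomial K := aeval ![(Polynomial.X : Polynomial K), 1] P.leadingCoeff with hρ
  have hρ0 : ρ ≠ 0 := by
    intro h0
    apply Polynomial.leadingCoeff_ne_zero.mpr hP0
    refine binary_form _ _ hlc _ _ ?_ h0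
    intro α β hz
    have z1 := congrArg (fun p => Polynomial.coeff p 1) hz
    have z0 := congrArg (fun p => Polynomial.coeff p 0) hz
    simp [Polynomial.coeff_one] at z0 z1
    exact ⟨z1, z0⟩
  set dl : Polynomial K := Polynomial.C (b1.coeff N) - Polynomial.C (b2.coeff N) * Polynomial.X
    with hdl
  have hdl0 : dl ≠ 0 := by
    intro h0
    have z0 := congrArg (fun p => Polynomial.coeff p 0) h0
    have z1 := congrArg (fun p => Polynomial.coeff p 1) h0
    simp [hdl, Polynomial.coeff_C] at z0 z1
    rcases le_total b1.natDegree b2.natDegree with hle | hle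
    · rw [hN, max_eq_right hle] at z1
      exact hb2 (Polynomial.leadingCoeff_eq_zero.mp z1)
    · rw [hN, max_eq_left hle] at z0 z1
      have hb1 := Polynomial.leadingCoeff_eq_zero.mp z0
      rw [hb1, Polynomial.natDegree_zero] at hle z1
      apply hb2
      rw [Polynomial.eq_C_of_natDegree_eq_zero (Nat.le_zero.mp hle), z1, map_zero]
  have hbad : (((fun τ => b1.eval τ / b2.eval τ) '' T) ∪ ((ρ * dl).roots.toFinset : Set K)).Finite :=
    (hTfin.image _).union (Finset.finite_toSet _)
  obtain ⟨c, hc⟩ := hbad.infinite_compl.nonempty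
  simp only [Set.mem_compl_iff, Set.mem_union, not_or] at hc
  obtain ⟨hcT, hcr⟩ := hc
  have hcr' : ρ.eval c ≠ 0 ∧ dl.eval c ≠ 0 := by
    simpa [hρ0, hdl0] using hcr
  set B := b1 - Polynomial.C c * b2 with hB
  have hBN : B.coeff N ≠ 0 := by
    have := hcr'.2
    simp only [hdl, Polynomial.eval_sub, Polynomial.eval_mul, Polynomial.eval_C,
      Polynomial.eval_X] at this
    rw [hB, Polynomial.coeff_sub, Polynomial.coeff_C_mul, mul_comm c]
    exact this
  have hB0 : B ≠ 0 := by
    intro h0; rw [h0] at hBN; simp at hBN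
  have hNle : N ≤ B.natDegree := Polynomial.le_natDegree_of_ne_zero hBN
  have hroot : ∀ τ, B.eval τ = 0 → b2.eval τ ≠ 0 ∧ b1.eval τ = c * b2.eval τ ∧ τ ∉ T := by
    intro τ hτ
    have h1 : b1.eval τ = c * b2.eval τ := by
      simp only [hB, Polynomial.eval_sub, Polynomial.eval_mul, Polynomial.eval_C] at hτ
      linear_combination hτ
    have h2 : b2.eval τ ≠ 0 := by
      intro h2
      obtain ⟨s, t, hst⟩ := hco
      have := congrArg (Polynomial.eval τ) hst
      simp [h1, h2] at this
    refine ⟨h2, h1, ?_⟩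
    intro hτT
    apply hcT
    refine ⟨τ, hτT, ?_⟩
    simp only [h1]
    field_simp
  have hgW : ∀ τ, τ ∉ T → τ ∉ S ∧ g.eval τ ≠ 0 ∧ (Polynomial.wronskian b1 b2).eval τ ≠ 0 := by
    intro τ hτ
    simpa [hT, hg, hW] using hτ
  have hsep : B.Separable := by
    rw [Polynomial.Separable, Polynomial.isCoprime_iff_aeval_ne_zero_of_isAlgClosed K K]
    intro τ
    by_contra hc
    push Not at hc
    simp only [Polynomial.coe_aeval_eq_eval] at hc
    obtain ⟨h1, h2⟩ := hc
    obtain ⟨h3, h4, h5⟩ := hroot τ h1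
    apply (hgW τ h5).2.2
    simp only [hB, Polynomial.derivative_sub, Polynomial.derivative_C_mul, Polynomial.eval_sub,
      Polynomial.eval_mul, Polynomial.eval_C] at h2
    rw [Polynomial.wronskian]
    simp only [Polynomial.eval_sub, Polynomial.eval_mul]
    linear_combination (Polynomial.eval τ (Polynomial.derivative b2)) * h4 - b2.eval τ * h2
  have hcard : B.roots.toFinset.card = B.natDegree := by
    rw [Multiset.toFinset_card_of_nodup (Polynomial.nodup_roots hsep),
      ← (IsAlgClosed.splits B).natDegree_eq_card_roots]
  set Q : Polynomial K := P.map ((aeval ![c, 1] : MvPolynomial (Fin 2) K →ₐ[K] K) :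
    MvPolynomial (Fin 2) K →+* K) with hQ
  have hQ0 : Q ≠ 0 := by
    intro h0
    have := congrArg (fun p => Polynomial.coeff p P.natDegree) h0
    simp only [hQ, Polynomial.coeff_map, Polynomial.coeff_zero] at this
    apply hcr'.1
    rw [hρ, ← Polynomial.coe_aeval_eq_eval, comp_aeval_apply, ← this]
    have hfun : (fun i => (Polynomial.aeval c) (![(Polynomial.X : Polynomial K), 1] i)) = ![c, 1] := by
      funext u; fin_cases u <;> simp
    rw [hfun]
    rfl
  have hQd : Q.natDegree ≤ P.natDegree := Polynomial.natDegree_map_le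
  have hle : B.roots.toFinset.card ≤ Q.roots.toFinset.card := by
    apply Finset.card_le_card_of_injOn (fun τ => (a 0).eval τ / (a 2).eval τ)
    · intro τ hτ
      have hτ' : B.eval τ = 0 := by simpa [hB0] using hτ
      obtain ⟨h3, h4, h5⟩ := hroot τ hτ'
      obtain ⟨h6, h7, h8⟩ := hgW τ h5
      have ha2 : (a 2).eval τ ≠ 0 := by rw [e2]; simp [h3, h7]
      suffices Q.eval ((a 0).eval τ / (a 2).eval τ) = 0 by simpa [hQ0] using this
      have h9 : aeval ![(a 0).eval τ / (a 2).eval τ, c, 1] F = 0 := by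
        have hz := congrArg (Polynomial.aeval τ) h.zero
        rw [comp_aeval_apply, map_zero] at hz
        have hfun : (fun i => (Polynomial.aeval τ) (a i)) =
            fun u => (a 2).eval τ * ![(a 0).eval τ / (a 2).eval τ, c, 1] u := by
          funext u
          fin_cases u
          · simp; field_simp
          · simp [e1, e2, h4]; ring
          · simp
        rw [hfun, hom_scale F n h.hom] at hz
        exact (mul_eq_zero.mp hz).resolve_left (pow_ne_zero _ ha2)
      rw [aeval_finSucc] at h9
      rw [hQ, Polynomial.eval_map]
      exact h9
    · intro τ hτ τ' hτ' heq
      have hτ1 : B.eval τ = 0 := by simpa [hB0] using hτ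
      have hτ1' : B.eval τ' = 0 := by simpa [hB0] using hτ'
      obtain ⟨h3, h4, h5⟩ := hroot τ hτ1
      obtain ⟨h6, h7, h8⟩ := hgW τ h5
      have ha2 : (a 2).eval τ ≠ 0 := by rw [e2]; simp [h3, h7]
      obtain ⟨h3', h4', h5'⟩ := hroot τ' hτ1'
      obtain ⟨h6', h7', h8'⟩ := hgW τ' h5'
      have ha2' : (a 2).eval τ' ≠ 0 := by rw [e2]; simp [h3', h7']
      apply hinj τ h6 τ' h6' ((a 2).eval τ' / (a 2).eval τ)
      simp only at heq
      have q1 : (a 1).eval τ = c * (a 2).eval τ := by rw [e1, e2]; simp [h4]; ring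
      have q1' : (a 1).eval τ' = c * (a 2).eval τ' := by rw [e1, e2]; simp [h4']; ring
      intro u
      fin_cases u
      · change (a 0).eval τ' = _ * (a 0).eval τ
        field_simp at heq ⊢
        linear_combination -heq
      · change (a 1).eval τ' = _ * (a 1).eval τ
        rw [q1, q1']
        field_simp
      · change (a 2).eval τ' = _ * (a 2).eval τ
        field_simp
  have := Multiset.toFinset_card_le Q.roots
  have := Polynomial.card_roots' Q
  omega

theorem dir2 {K : Type*} [Field K] [IsAlgClosed K] [CharZero K] {n : ℕ} (hn : 3 ≤ n)
    (k : ℕ) (hk : k ≤ n)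
    {a : Fin 3 → Polynomial K} {F : MvPolynomial (Fin 3) K} (h : Core n a F)
    (hd : (finSuccEquiv K 2 F).natDegree ≤ n - k) : Good n k a := by
  classical
  have ha2 : a 2 ≠ 0 := by
    intro h0
    have := h.indep hn 0 1 (by rw [h0]; simp)
    simp at this
  obtain ⟨g, b1, b2, hg, hco, e1, e2⟩ : ∃ g b1 b2 : Polynomial K, g ≠ 0 ∧ IsCoprime b1 b2 ∧
      a 1 = g * b1 ∧ a 2 = g * b2 := by
    have hg : EuclideanDomain.gcd (a 1) (a 2) ≠ 0 := fun h0 =>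
      ha2 (EuclideanDomain.gcd_eq_zero_iff.mp h0).2
    obtain ⟨b1, hb1⟩ := EuclideanDomain.gcd_dvd_left (a 1) (a 2)
    obtain ⟨b2, hb2⟩ := EuclideanDomain.gcd_dvd_right (a 1) (a 2)
    refine ⟨_, b1, b2, hg, ?_, hb1, hb2⟩
    refine ⟨EuclideanDomain.gcdA (a 1) (a 2), EuclideanDomain.gcdB (a 1) (a 2), ?_⟩
    have := EuclideanDomain.gcd_eq_gcd_ab (a 1) (a 2)
    apply mul_left_cancel₀ hg
    linear_combination (-1 : Polynomial K) * this + EuclideanDomain.gcdA (a 1) (a 2) * (-hb1) +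
      EuclideanDomain.gcdB (a 1) (a 2) * (-hb2)
  have hN := (count hn h g b1 b2 hg e1 e2 hco).trans hd
  obtain ⟨q, r, hgr, hq⟩ := exists_factor g hg (min k g.natDegree) (min_le_right _ _)
  have hq0 : q ≠ 0 := by rintro rfl; simp at hgr; exact hg hgr
  have hr0 : r ≠ 0 := by rintro rfl; simp at hgr; exact hg hgr
  have hdeg : g.natDegree = q.natDegree + r.natDegree := by
    rw [hgr, Polynomial.natDegree_mul hq0 hr0]
  have key : ∀ (i : Fin 3) (b : Polynomial K), a i = g * b → b.natDegree ≤ n - k →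
      ∃ b : Polynomial K, b.natDegree ≤ n - k ∧ a i = q * b := by
    intro i b hab hb
    refine ⟨r * b, ?_, by rw [hab, hgr, mul_assoc]⟩
    by_cases hb0 : b = 0
    · simp [hb0]
    · have h1 := h.deg i
      rw [hab, Polynomial.natDegree_mul hg hb0] at h1
      rw [Polynomial.natDegree_mul hr0 hb0]
      rcases le_total k g.natDegree with hle | hle
      · rw [min_eq_left hle] at hq; omega
      · rw [min_eq_right hle] at hq; omega
  refine ⟨q, hq0, by rw [hq]; exact min_le_left _ _, ?_⟩
  intro i hi
  fin_cases i
  · exact absurd rfl hi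
  · exact key 1 b1 e1 ((le_max_left _ _).trans hN)
  · exact key 2 b2 e2 ((le_max_right _ _).trans hN)

theorem core_of_param {K : Type*} [Field K] (n : ℕ) (f : Fin 3 → MvPolynomial (Fin 2) K)
    (hf : IsProperParam n f)
    (F : MvPolynomial (Fin 3) K) (hFirr : Irreducible F) (hFhom : F.IsHomogeneous n)
    (hFf : MvPolynomial.aeval f F = 0) : Core n (dehom f) F := by
  refine ⟨dehom_natDegree n f hf.homog, hFirr, hFhom, ?_, ?_⟩
  · have := congrArg (aeval ![(1 : Polynomial K), Polynomial.X]) hFf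
    rw [comp_aeval_apply, map_zero] at this
    exact this
  · obtain ⟨S, hS, hinj⟩ := hf.gen_injective
    have hv : ∀ τ : K, (![1, τ] : Fin 2 → K) ≠ 0 := fun τ h0 => one_ne_zero (congrFun h0 0)
    let pt : K → Projectivization K (Fin 2 → K) := fun τ => Projectivization.mk K ![1, τ] (hv τ)
    have hpt : Function.Injective pt := by
      intro τ τ' h
      obtain ⟨c, hc⟩ := (Projectivization.mk_eq_mk_iff' K _ _ _ _).mp h
      have h0 := congrFun hc 0
      have h1 := congrFun hc 1
      simp at h0 h1
      rw [← h1, h0, one_mul]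
    have hev : ∀ τ u, (dehom f u).eval τ = MvPolynomial.eval ![1, τ] (f u) := by
      intro τ u
      rw [dehom, ← Polynomial.coe_aeval_eq_eval, comp_aeval_apply, ← aeval_eq_eval]
      have hfun : (fun i => (Polynomial.aeval τ) (![(1 : Polynomial K), Polynomial.X] i)) =
          ![1, τ] := by
        funext u; fin_cases u <;> simp
      rw [hfun]
    have hproj : ∀ τ, projMap f (pt τ) = Projectivization.mk K (evalVec f ![1, τ])
        (hf.no_common_zero _ (hv τ)) := by
      intro τ
      have hne : evalVec f (pt τ).rep ≠ 0 := hf.no_common_zero _ (pt τ).rep_nonzero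
      rw [projMap, dif_pos hne, Projectivization.mk_eq_mk_iff']
      obtain ⟨s, hs⟩ := Projectivization.exists_smul_eq_mk_rep K _ (hv τ)
      refine ⟨(s : K) ^ n, ?_⟩
      funext u
      have h1 := hom_scale (f u) n (hf.homog u) (s : K) ![1, τ]
      simp only [aeval_eq_eval] at h1
      change (s : K) ^ n * MvPolynomial.eval ![1, τ] (f u) = MvPolynomial.eval (pt τ).rep (f u)
      rw [← hs]
      exact h1.symm
    refine ⟨pt ⁻¹' S, hS.preimage hpt.injOn, ?_⟩
    intro τ hτ τ' hτ' c hc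
    apply hpt
    apply hinj hτ hτ'
    rw [hproj, hproj, eq_comm, Projectivization.mk_eq_mk_iff']
    refine ⟨c, ?_⟩
    funext u
    have := hc u
    rw [hev, hev] at this
    exact this.symm

/-- For every `2 ≤ k ≤ n-1`, the set `X_k(K)` is nonempty if and only if `C` has a singular
point of multiplicity at least `k`. -/
theorem statement_4 {K : Type*} [Field K] [IsAlgClosed K] [CharZero K]
    (n : ℕ) (hn : 3 ≤ n) (f : Fin 3 → MvPolynomial (Fin 2) K)
    (hf : IsProperParam n f)
    (F : MvPolynomial (Fin 3) K) (hFirr : Irreducible F) (hFhom : F.IsHomogeneous n)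
    (hFf : MvPolynomial.aeval f F = 0) :
    ∀ k : ℕ, 2 ≤ k → k ≤ n - 1 →
      ((XkSet n k f).Nonempty ↔ ∃ p : Fin 3 → K, p ≠ 0 ∧ k ≤ multAt F p) := by
  intro k hk2 hkn
  have hkn' : k ≤ n := by omega
  have hcore := core_of_param n f hf F hFirr hFhom hFf
  rw [Xk_iff n k hkn' f hf.homog]
  constructor
  · rintro ⟨A, B, hAB, hgood⟩
    have hT := hcore.transport A B hAB
    have hd := dir1 hn k hkn' hT hgood
    rw [← natDegree_iff n k hkn' _ hT.hom] at hd
    refine ⟨B.mulVec ![1, 0, 0], ?_, ?_⟩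
    · intro h0
      have h1 := congrArg A.mulVec h0
      rw [Matrix.mulVec_mulVec, hAB, Matrix.one_mulVec, Matrix.mulVec_zero] at h1
      exact one_ne_zero (congrFun h1 0)
    · exact (multAt_iff A B hAB _ rfl k n (by omega) F hFirr.ne_zero hFhom).mpr hd
  · rintro ⟨p, hp, hm⟩
    obtain ⟨A', B', hAB', hA'⟩ := aux_first p hp
    have hAB : B'.transpose * A'.transpose = 1 := by
      rw [← Matrix.transpose_mul, hAB', Matrix.transpose_one]
    have hBp : A'.transpose.mulVec ![1, 0, 0] = p := by
      rw [← hA']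
      funext i
      simp [Matrix.mulVec, dotProduct, Fin.sum_univ_three]
    rw [multAt_iff _ _ hAB p hBp k n (by omega) F hFirr.ne_zero hFhom,
      natDegree_iff n k hkn' _ (subst_hom _ _ _ hFhom)] at hm
    exact ⟨_, _, hAB, dir2 hn k hkn' (hcore.transport _ _ hAB) hm⟩

end
end

section
/- Let k ≥ 1 and let λ, λ' be partitions of k. Then R_λ(K) ⊆ R_{λ'}(K) if and only if λ ⪯ λ', where λ ⪯ λ' means that the multiset of nonzero parts of λ' can be split into blocks indexed by the nonzero parts of λ such that for each i the block assigned to the part λ_i has sum λ_i (i.e., λ' is obtained from λ by replacing each part by the parts of some partition of it). -/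
open MvPolynomial

noncomputable section

/-- `lam` is a partition of `k`: a weakly decreasing `k`-tuple of nonnegative integers
summing to `k`. -/
def IsPartitionOf (k : ℕ) (lam : Fin k → ℕ) : Prop :=
  Antitone lam ∧ ∑ i, lam i = k

/-- The subset `R_λ(K) ⊆ ℙ^k(K)` of classes of binary forms of degree `k` which factor as
`L_1^{λ_1} ⋯ L_k^{λ_k}` with the `L_i` linear forms. -/
def Rlambda {K : Type*} [Field K] (k : ℕ) (lam : Fin k → ℕ) :
    Set (Projectivization K (Fin (k + 1) → K)) :=
  { P | ∃ L : Fin k → K × K,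
      formOf k P.rep =
        ∏ i : Fin k, (MvPolynomial.C (L i).1 * MvPolynomial.X 0
          + MvPolynomial.C (L i).2 * MvPolynomial.X 1) ^ lam i }

/-- `lam ⪯ lam'`: the multiset of nonzero parts of `lam'` can be split into blocks indexed
by the parts of `lam`, the block assigned to the part `lam i` summing to `lam i`. -/
def PartRefines {k : ℕ} (lam lam' : Fin k → ℕ) : Prop :=
  ∃ g : Fin k → Fin k,
    ∀ i : Fin k, ∑ j ∈ Finset.univ.filter (fun j => g j = i), lam' j = lam i

lemma aux_formOf_bcoeff {K : Type*} [Field K] (k : ℕ) (F : MvPolynomial (Fin 2) K)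
    (hF : F.IsHomogeneous k) : formOf k (bcoeff k F) = F := by
  have key : ∀ i : Fin (k + 1),
      MvPolynomial.C (bcoeff k F i) * MvPolynomial.X 0 ^ (k - (i : ℕ))
        * MvPolynomial.X 1 ^ (i : ℕ)
      = MvPolynomial.monomial
          (Finsupp.single (0 : Fin 2) (k - (i : ℕ)) + Finsupp.single 1 (i : ℕ))
          (bcoeff k F i) := by
    intro i
    rw [MvPolynomial.X_pow_eq_monomial, MvPolynomial.X_pow_eq_monomial,
      MvPolynomial.C_mul_monomial, MvPolynomial.monomial_mul]
    simp
  unfold formOf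
  simp_rw [key]
  ext m
  rw [MvPolynomial.coeff_sum]
  simp_rw [MvPolynomial.coeff_monomial]
  by_cases hm : m 0 + m 1 = k
  · rw [Finset.sum_eq_single (⟨m 1, by omega⟩ : Fin (k + 1))]
    · have e : (Finsupp.single (0 : Fin 2) (k - m 1) + Finsupp.single 1 (m 1)) = m := by
        ext j
        fin_cases j
        · simp; omega
        · simp
      simp only [bcoeff]
      rw [e]
      simp
    · intro b _ hb
      rw [if_neg]
      intro h
      apply hb
      have h' := DFunLike.congr_fun h 1
      simp at h'
      exact Fin.ext h'
    · simp
  · rw [Finset.sum_eq_zero]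
    · symm
      by_contra h
      have := hF h
      apply hm
      rw [← this, Finsupp.weight_apply, Finsupp.sum_fintype _ _ (by simp)]
      simp [Fin.sum_univ_two]
    · intro i _
      rw [if_neg]
      intro h
      apply hm
      rw [← h]
      simp
      omega

lemma aux_formOf_smul {K : Type*} [Field K] (k : ℕ) (a : K) (x : Fin (k + 1) → K) :
    formOf k (a • x) = MvPolynomial.C a * formOf k x := by
  simp [formOf, Finset.mul_sum, mul_assoc]

lemma aux_rootMult {K : Type*} [Field K] {k : ℕ} (a : Fin k → K) (ha : Function.Injective a)
    (m : Fin k → ℕ) (i : Fin k) :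
    (∏ j, (Polynomial.X - Polynomial.C (a j)) ^ m j).rootMultiplicity (a i) = m i := by
  classical
  rw [← Polynomial.count_roots, Polynomial.roots_prod]
  · simp only [Polynomial.roots_pow, Polynomial.roots_X_sub_C]
    rw [Multiset.count_bind]
    change ∑ j, Multiset.count (a i) (m j • {a j}) = m i
    rw [Finset.sum_eq_single i]
    · simp
    · intro j _ hj
      simp [Multiset.count_singleton, ha.ne hj.symm]
    · simp
  · exact Finset.prod_ne_zero_iff.mpr fun j _ => pow_ne_zero _ (Polynomial.X_sub_C_ne_zero _)

lemma aux_forward {K : Type*} [Field K] {k : ℕ} (hk : 1 ≤ k) (a : Fin k → K)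
    (ha : Function.Injective a) (lam lam' : Fin k → ℕ) (c : K) (hc : c ≠ 0)
    (L : Fin k → K × K)
    (h : MvPolynomial.C c * ∏ i : Fin k, (MvPolynomial.C (-(a i)) * MvPolynomial.X 0
          + MvPolynomial.C 1 * MvPolynomial.X 1) ^ lam i =
        ∏ i : Fin k, (MvPolynomial.C (L i).1 * MvPolynomial.X (0 : Fin 2)
          + MvPolynomial.C (L i).2 * MvPolynomial.X 1) ^ lam' i) :
    PartRefines lam lam' := by
  have h1 := congrArg (MvPolynomial.eval ![(0 : K), 1]) h
  simp [MvPolynomial.eval_prod] at h1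
  have hb : ∀ j, lam' j ≠ 0 → (L j).2 ≠ 0 := by
    intro j hj h0
    apply hc
    rw [h1]
    exact Finset.prod_eq_zero (Finset.mem_univ j) (by rw [h0, zero_pow hj])
  have hroot : ∀ j, lam' j ≠ 0 → ∃ i, -(L j).1 / (L j).2 = a i := by
    intro j hj
    have h2 := congrArg (MvPolynomial.eval ![(1 : K), -(L j).1 / (L j).2]) h
    simp only [map_mul, map_prod, map_pow, map_add, MvPolynomial.eval_C,
      MvPolynomial.eval_X] at h2
    have hz := hb j hj
    rw [Finset.prod_eq_zero (s := Finset.univ) (i := j)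
      (f := fun i => ((L i).1 * ![(1 : K), -(L j).1 / (L j).2] 0
        + (L i).2 * ![(1 : K), -(L j).1 / (L j).2] 1) ^ lam' i) (Finset.mem_univ j)] at h2
    · rcases mul_eq_zero.mp h2 with h2 | h2
      · exact absurd h2 hc
      · obtain ⟨i, _, hi⟩ := Finset.prod_eq_zero_iff.mp h2
        refine ⟨i, ?_⟩
        have := (pow_eq_zero_iff').mp hi |>.1
        simp at this
        linear_combination this
    · simp only [Matrix.cons_val_zero, Matrix.cons_val_one]
      rw [mul_div_cancel₀ _ hz]
      simp [hj]
  have hg : ∀ j, ∃ i, lam' j ≠ 0 → -(L j).1 / (L j).2 = a i := by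
    intro j
    by_cases hj : lam' j = 0
    · exact ⟨⟨0, hk⟩, fun h => absurd hj h⟩
    · obtain ⟨i, hi⟩ := hroot j hj
      exact ⟨i, fun _ => hi⟩
  choose g hg using hg
  refine ⟨g, fun i => ?_⟩
  have h3 := congrArg (MvPolynomial.aeval ![(1 : Polynomial K), Polynomial.X]) h
  simp only [map_mul, map_prod, map_pow, map_add, MvPolynomial.aeval_C,
      MvPolynomial.aeval_X, Matrix.cons_val_zero, Matrix.cons_val_one,
      Polynomial.algebraMap_eq, mul_one, one_mul, map_one] at h3
  have e1 : ∀ i, Polynomial.C (-(a i)) + Polynomial.X = Polynomial.X - Polynomial.C (a i) := by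
    intro i; rw [Polynomial.C_neg]; ring
  have e2 : ∀ j, (Polynomial.C (L j).1 + Polynomial.C (L j).2 * Polynomial.X) ^ lam' j
      = Polynomial.C ((L j).2 ^ lam' j) * (Polynomial.X - Polynomial.C (a (g j))) ^ lam' j := by
    intro j
    by_cases hj : lam' j = 0
    · simp [hj]
    · rw [← hg j hj, Polynomial.C_pow, ← mul_pow]
      congr 1
      rw [mul_sub, ← Polynomial.C_mul, mul_div_cancel₀ _ (hb j hj), Polynomial.C_neg]
      ring
  simp_rw [e1, e2] at h3
  rw [Finset.prod_mul_distrib, ← map_prod, ← h1] at h3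
  have h4 := mul_left_cancel₀ (Polynomial.C_ne_zero.mpr hc) h3
  have e3 : ∏ j, (Polynomial.X - Polynomial.C (a (g j))) ^ lam' j
      = ∏ i, (Polynomial.X - Polynomial.C (a i)) ^
        (∑ j ∈ Finset.univ.filter (fun j => g j = i), lam' j) := by
    rw [← Finset.prod_fiberwise (s := Finset.univ) (g := g)]
    refine Finset.prod_congr rfl fun i _ => ?_
    rw [← Finset.prod_pow_eq_pow_sum]
    refine Finset.prod_congr rfl fun j hj => ?_
    rw [(Finset.mem_filter.mp hj).2]
  rw [e3] at h4
  have h5 := congrArg (Polynomial.rootMultiplicity (a i)) h4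
  rw [aux_rootMult a ha, aux_rootMult a ha] at h5
  exact h5.symm

/-- For partitions `λ, λ'` of `k`, one has `R_λ(K) ⊆ R_{λ'}(K)` if and only if `λ ⪯ λ'`. -/
theorem statement_7 {K : Type*} [Field K] [IsAlgClosed K] [CharZero K]
    (k : ℕ) (hk : 1 ≤ k) (lam lam' : Fin k → ℕ)
    (hlam : IsPartitionOf k lam) (hlam' : IsPartitionOf k lam') :
    Rlambda (K := K) k lam ⊆ Rlambda (K := K) k lam' ↔ PartRefines lam lam' := by
  constructor
  · intro hsub
    set a : Fin k → K := fun i => ((i : ℕ) : K) with ha_def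
    have ha : Function.Injective a := fun i j hij => Fin.ext (Nat.cast_injective hij)
    set F : MvPolynomial (Fin 2) K := ∏ i : Fin k, (MvPolynomial.C (-(a i)) * MvPolynomial.X 0
          + MvPolynomial.C 1 * MvPolynomial.X 1) ^ lam i with hF_def
    have hF : F.IsHomogeneous k := by
      have := MvPolynomial.IsHomogeneous.prod Finset.univ
        (fun i : Fin k => (MvPolynomial.C (-(a i)) * MvPolynomial.X (0 : Fin 2)
          + MvPolynomial.C 1 * MvPolynomial.X 1) ^ lam i) lam (by
          intro i _
          have h1 : (MvPolynomial.C (-(a i)) * MvPolynomial.X (0 : Fin 2)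
            + MvPolynomial.C 1 * MvPolynomial.X 1 : MvPolynomial (Fin 2) K).IsHomogeneous 1 :=
            ((MvPolynomial.isHomogeneous_X K 0).C_mul _).add
              ((MvPolynomial.isHomogeneous_X K 1).C_mul _)
          simpa using h1.pow (lam i))
      rwa [hlam.2] at this
    have hF0 : F ≠ 0 := by
      intro h0
      have := congrArg (MvPolynomial.eval ![(0 : K), 1]) h0
      simp [hF_def, MvPolynomial.eval_prod] at this
    have hx := aux_formOf_bcoeff k F hF
    have hx0 : bcoeff k F ≠ 0 := by
      intro h0
      apply hF0
      rw [← hx, h0]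
      simp [formOf]
    obtain ⟨u, hu⟩ := Projectivization.exists_smul_eq_mk_rep K (bcoeff k F) hx0
    have hrep : formOf k (Projectivization.mk K (bcoeff k F) hx0).rep
        = MvPolynomial.C (u : K) * F := by
      rw [← hu, Units.smul_def, aux_formOf_smul, hx]
    obtain ⟨d, hd⟩ := IsAlgClosed.exists_pow_nat_eq (u : K) (n := k) (by omega)
    have hmem : Projectivization.mk K (bcoeff k F) hx0 ∈ Rlambda (K := K) k lam := by
      refine ⟨fun i => (d * -(a i), d * 1), ?_⟩
      rw [hrep, ← hd, hF_def]
      have : (MvPolynomial.C (d ^ k) : MvPolynomial (Fin 2) K)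
          = ∏ i : Fin k, MvPolynomial.C d ^ lam i := by
        rw [Finset.prod_pow_eq_pow_sum, hlam.2, map_pow]
      rw [this, ← Finset.prod_mul_distrib]
      refine Finset.prod_congr rfl fun i _ => ?_
      rw [← mul_pow]
      simp only [map_mul]
      ring
    obtain ⟨L, hL⟩ := hsub hmem
    rw [hrep] at hL
    exact aux_forward hk a ha lam lam' u u.ne_zero L hL
  · rintro ⟨g, hg⟩ P ⟨L, hL⟩
    refine ⟨fun j => L (g j), ?_⟩
    rw [hL, ← Finset.prod_fiberwise (s := Finset.univ) (g := g)
      (f := fun j => (MvPolynomial.C (L (g j)).1 * MvPolynomial.X 0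
          + MvPolynomial.C (L (g j)).2 * MvPolynomial.X 1) ^ lam' j)]
    refine Finset.prod_congr rfl fun i _ => ?_
    rw [← hg i, ← Finset.prod_pow_eq_pow_sum]
    refine Finset.prod_congr rfl fun j hj => ?_
    rw [(Finset.mem_filter.mp hj).2]

end
end
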